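/- arXiv:1703.03955 — 7 statements merged into one kernel-verified Lean document; each statement's English description precedes it below -/
import Mathlib

section
/- Let n ≥ 1 and W = S_{n+1}. If I = R − {s_i} and J = R − {s_j} for some 1 ≤ i, j ≤ n (i.e., both complements are singletons), then X⁺_{I,J} is totally ordered by the Bruhat order (it is a chain). -/
/-- The number of inversions (Coxeter length) of a permutation of `Fin m`. -/
def sLen {m : ℕ} (w : Equiv.Perm (Fin m)) : ℕ :=
  (Finset.univ.filter fun p : Fin m × Fin m => p.1 < p.2 ∧ w p.2 < w p.1).card

/-- The Bruhat order on the symmetric group: generated by `w < t * w` for a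
transposition `t` with `sLen (t * w) > sLen w`. -/
def bruhatLE {m : ℕ} (u v : Equiv.Perm (Fin m)) : Prop :=
  Relation.ReflTransGen
    (fun x y => (∃ a b : Fin m, a ≠ b ∧ y = Equiv.swap a b * x) ∧ sLen x < sLen y) u v

/-- The right descent set of `w`, as a set of indices of simple reflections:
`i : Fin n` stands for the simple transposition `s_{i+1} = (i+1, i+2)` (1-based). -/
def Des {n : ℕ} (w : Equiv.Perm (Fin (n + 1))) : Set (Fin n) :=
  {i | w i.succ < w i.castSucc}

/-- Maximal-length double-coset representatives:
`X⁺_{I,J} = {w : I ⊆ Des (w⁻¹) ∧ J ⊆ Des w}`. -/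
def Xplus {n : ℕ} (I J : Set (Fin n)) : Set (Equiv.Perm (Fin (n + 1))) :=
  {w | I ⊆ Des w⁻¹ ∧ J ⊆ Des w}

/-- A subset of the symmetric group is totally ordered (a chain) in Bruhat order. -/
def IsChainOn {m : ℕ} (X : Set (Equiv.Perm (Fin m))) : Prop :=
  ∀ x ∈ X, ∀ y ∈ X, bruhatLE x y ∨ bruhatLE y x

/-- A subset of the symmetric group, with the restriction of the Bruhat order,
is a lattice: every pair has a least upper bound and a greatest lower bound in the set. -/
def IsLatticeOn {m : ℕ} (X : Set (Equiv.Perm (Fin m))) : Prop :=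
  (∀ x ∈ X, ∀ y ∈ X, ∃ z ∈ X, bruhatLE x z ∧ bruhatLE y z ∧
      ∀ t ∈ X, bruhatLE x t → bruhatLE y t → bruhatLE z t) ∧
  (∀ x ∈ X, ∀ y ∈ X, ∃ z ∈ X, bruhatLE z x ∧ bruhatLE z y ∧
      ∀ t ∈ X, bruhatLE t x → bruhatLE t y → bruhatLE t z)

/-- `y` covers `x` in the restriction of the Bruhat order to `X`. -/
def CoversIn {m : ℕ} (X : Set (Equiv.Perm (Fin m))) (x y : Equiv.Perm (Fin m)) : Prop :=
  x ∈ X ∧ y ∈ X ∧ bruhatLE x y ∧ x ≠ y ∧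
    ∀ z ∈ X, bruhatLE x z → bruhatLE z y → z = x ∨ z = y

/-- Composing with the transposition of a non-inverted pair of positions increases the length. -/
theorem sLen_lt_sLen_mul_swap {m : ℕ} (z : Equiv.Perm (Fin m)) {p q : Fin m} (hpq : p < q)
    (hz : z p < z q) : sLen z < sLen (z * Equiv.swap p q) := by
  unfold sLen
  set S := Finset.univ.filter fun a : Fin m × Fin m => a.1 < a.2 ∧ z a.2 < z a.1 with hS
  set T := Finset.univ.filter fun a : Fin m × Fin m =>
    a.1 < a.2 ∧ (z * Equiv.swap p q) a.2 < (z * Equiv.swap p q) a.1 with hT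
  have hmem : (p, q) ∈ T := by
    rw [hT, Finset.mem_filter]
    simp [hpq, hz]
  rw [← Finset.card_erase_add_one hmem, Nat.lt_add_one_iff]
  refine Finset.card_le_card_of_injOn (fun a =>
    if Equiv.swap p q a.1 < Equiv.swap p q a.2 then (Equiv.swap p q a.1, Equiv.swap p q a.2)
    else a) ?_ ?_
  · rintro ⟨a, b⟩ hab
    simp only [hS, Finset.coe_filter, Finset.mem_univ, true_and, Set.mem_ofPred_eq] at hab
    obtain ⟨hab, hzab⟩ := hab
    rw [Finset.mem_coe, Finset.mem_erase, hT, Finset.mem_filter_univ, and_comm]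
    simp only [Equiv.Perm.mul_apply]
    split_ifs with h
    · refine ⟨⟨h, by simpa using hzab⟩, fun h' => ?_⟩
      simp only [Prod.mk.injEq] at h'
      have h1 : a = q := by rw [← Equiv.swap_apply_self p q a, h'.1, Equiv.swap_apply_left]
      have h2 : b = p := by rw [← Equiv.swap_apply_self p q b, h'.2, Equiv.swap_apply_right]
      grind
    · simp only [Equiv.swap_apply_def] at h ⊢
      grind
  · rintro ⟨a, b⟩ hab ⟨c, d⟩ hcd h
    simp only [hS, Finset.coe_filter, Finset.mem_univ, true_and, Set.mem_ofPred_eq] at hab hcd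
    dsimp only at h
    split_ifs at h with h1 h2 h2
    · simpa using h
    · simp only [Prod.mk.injEq] at h
      exact absurd hab.1 (by rw [← h.1, ← h.2] at h2; simpa using h2)
    · simp only [Prod.mk.injEq] at h
      exact absurd hcd.1 (by rw [h.1, h.2] at h1; simpa using h1)
    · exact h

theorem sLen_le {m : ℕ} (w : Equiv.Perm (Fin m)) : sLen w ≤ m * m := by
  simpa [sLen] using Finset.card_le_univ
    (Finset.univ.filter fun p : Fin m × Fin m => p.1 < p.2 ∧ w p.2 < w p.1)

theorem bruhatLE_of_mul_swap {m : ℕ} {z y : Equiv.Perm (Fin m)} {p q : Fin m} (hpq : p < q)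
    (hz : z p < z q) (h : bruhatLE (z * Equiv.swap p q) y) : bruhatLE z y :=
  Relation.ReflTransGen.head
    ⟨⟨z p, z q, hz.ne, Equiv.mul_swap_eq_swap_mul z p q⟩, sLen_lt_sLen_mul_swap z hpq hz⟩ h

/-- A permutation whose descents include every index but `j` is decreasing on each of the two
blocks of positions cut out by `j`. -/
theorem apply_lt_apply_of_compl_subset_Des {n : ℕ} {f : Equiv.Perm (Fin (n + 1))} {j : Fin n}
    (hf : ({j} : Set (Fin n))ᶜ ⊆ Des f) {p q : Fin (n + 1)} (hpq : p < q)
    (h : p ≤ j.castSucc ↔ q ≤ j.castSucc) : f q < f p := by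
  induction q using Fin.induction with
  | zero => exact absurd hpq (Fin.not_lt_zero p)
  | succ l ih =>
    have hlj : l ≠ j := by
      rintro rfl
      simp only [Fin.lt_def, Fin.le_def, Fin.val_succ, Fin.val_castSucc] at hpq h
      omega
    have hl : f l.succ < f l.castSucc := hf hlj
    rcases eq_or_ne p l.castSucc with rfl | hp
    · exact hl
    · refine hl.trans (ih ?_ ?_)
      all_goals
        simp only [Fin.lt_def, Fin.le_def, Fin.val_succ, Fin.val_castSucc, ne_eq, Fin.ext_iff]
          at hpq h hp hlj ⊢
        omega

/-- The number of positions up to `a` at which `w` takes a value up to `b`. -/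
def lowCount {m : ℕ} (a b : Fin m) (w : Equiv.Perm (Fin m)) : ℕ :=
  (Finset.univ.filter fun p => p ≤ a ∧ w p ≤ b).card

theorem lowCount_mul_swap {m : ℕ} {a b p q : Fin m} (w : Equiv.Perm (Fin m))
    (h : p ≤ a ↔ q ≤ a) : lowCount a b (w * Equiv.swap p q) = lowCount a b w := by
  refine Finset.card_equiv (Equiv.swap p q) fun r => ?_
  have : Equiv.swap p q r ≤ a ↔ r ≤ a := by
    rw [Equiv.swap_apply_def]; grind
  rw [Finset.mem_filter_univ, Finset.mem_filter_univ]
  simp [this]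

theorem lowCount_swap_mul {m : ℕ} {a b u v : Fin m} (w : Equiv.Perm (Fin m))
    (h : u ≤ b ↔ v ≤ b) : lowCount a b (Equiv.swap u v * w) = lowCount a b w := by
  unfold lowCount
  congr 1
  ext r
  have : Equiv.swap u v (w r) ≤ b ↔ w r ≤ b := by
    rw [Equiv.swap_apply_def]; grind
  rw [Finset.mem_filter_univ, Finset.mem_filter_univ]
  simp [this]

theorem lowCount_mul_swap_add_one {m : ℕ} {a b p q : Fin m} (w : Equiv.Perm (Fin m))
    (hp : p ≤ a) (hq : ¬ q ≤ a) (hwp : w p ≤ b) (hwq : ¬ w q ≤ b) :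
    lowCount a b (w * Equiv.swap p q) + 1 = lowCount a b w := by
  unfold lowCount
  rw [← Finset.card_erase_add_one (s := Finset.univ.filter fun r => r ≤ a ∧ w r ≤ b) (a := p)
    (by simp [hp, hwp])]
  congr 2
  ext r
  simp only [Finset.mem_filter, Finset.mem_univ, true_and, Finset.mem_erase,
    Equiv.Perm.mul_apply, Equiv.swap_apply_def]
  grind

theorem card_filter_apply_le {m : ℕ} (b : Fin m) (w : Equiv.Perm (Fin m)) :
    (Finset.univ.filter fun p => w p ≤ b).card = b + 1 := by
  rw [← Fin.card_Iic b]
  exact Finset.card_equiv w fun r => by simp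

theorem lowCount_add_card {m : ℕ} (a b : Fin m) (w : Equiv.Perm (Fin m)) :
    lowCount a b w + (Finset.univ.filter fun p => ¬ p ≤ a ∧ w p ≤ b).card = b + 1 := by
  rw [← card_filter_apply_le b w, ← Finset.card_filter_add_card_filter_not
    (s := Finset.univ.filter fun p => w p ≤ b) (p := fun p => p ≤ a)]
  simp only [Finset.filter_filter, lowCount, and_comm]

theorem card_add_card_high {m : ℕ} (a b : Fin m) (w : Equiv.Perm (Fin m)) :
    (Finset.univ.filter fun p => ¬ p ≤ a ∧ w p ≤ b).card +
      (Finset.univ.filter fun p => ¬ p ≤ a ∧ ¬ w p ≤ b).card =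
      (Finset.univ.filter fun p : Fin m => ¬ p ≤ a).card := by
  rw [← Finset.card_filter_add_card_filter_not
    (s := Finset.univ.filter fun p : Fin m => ¬ p ≤ a) (p := fun p => w p ≤ b)]
  simp only [Finset.filter_filter]

/-- Two subsets of a block `P`, both closed upwards in `P`, coincide as soon as they have the
same size. -/
theorem filter_iff_of_card_eq {m : ℕ} {P Q Q' : Fin m → Prop} [DecidablePred P]
    [DecidablePred Q] [DecidablePred Q']
    (hQ : ∀ p q, p < q → P p → P q → Q p → Q q) (hQ' : ∀ p q, p < q → P p → P q → Q' p → Q' q)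
    (hcard : (Finset.univ.filter fun p => P p ∧ Q p).card =
      (Finset.univ.filter fun p => P p ∧ Q' p).card) {p : Fin m} (hp : P p) : Q p ↔ Q' p := by
  have key : (Finset.univ.filter fun p => P p ∧ Q p) = Finset.univ.filter fun p => P p ∧ Q' p := by
    by_cases h : (Finset.univ.filter fun p => P p ∧ Q p) ⊆ Finset.univ.filter fun p => P p ∧ Q' p
    · exact Finset.eq_of_subset_of_card_le h hcard.ge
    · obtain ⟨r, hr, hr'⟩ := Finset.not_subset.1 h
      simp only [Finset.mem_filter, Finset.mem_univ, true_and, not_and] at hr hr'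
      refine (Finset.eq_of_subset_of_card_le (fun s hs => ?_) hcard.le).symm
      simp only [Finset.mem_filter, Finset.mem_univ, true_and] at hs ⊢
      refine ⟨hs.1, ?_⟩
      rcases lt_trichotomy r s with hrs | rfl | hrs
      · exact hQ r s hrs hr.1 hs.1 hr.2
      · exact hr.2
      · exact absurd (hQ' s r hrs hs.1 hr.1 hs.2) (hr' hr.1)
  have := Finset.ext_iff.1 key p
  simpa [hp] using this

theorem perm_eq_of_lt_iff_lt {m : ℕ} {x y : Equiv.Perm (Fin m)}
    (h : ∀ p q, p < q → (x q < x p ↔ y q < y p)) : x = y := by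
  have hmono : StrictMono (fun r => y (x.symm r)) := by
    intro r s hrs
    have hne : x.symm r ≠ x.symm s := fun e => hrs.ne (x.symm.injective e)
    rcases lt_or_gt_of_ne hne with hlt | hlt
    · have h1 := h _ _ hlt
      have h2 : y (x.symm r) ≠ y (x.symm s) := fun e => hne (y.injective e)
      simp only [Equiv.apply_symm_apply] at h1
      exact lt_of_le_of_ne (not_lt.1 fun h3 => absurd (h1.2 h3) hrs.le.not_gt) h2
    · have h1 := h _ _ hlt
      simp only [Equiv.apply_symm_apply] at h1
      exact h1.1 hrs
  have hid : ∀ r, y (x.symm r) = r := fun r => by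
    have := Subsingleton.elim
      (hmono.orderIsoOfSurjective _ (y.surjective.comp x.symm.surjective)) (OrderIso.refl (Fin m))
    exact congrArg (fun e : Fin m ≃o Fin m => e r) this
  ext r
  simpa using congrArg Fin.val (hid (x r)).symm

theorem lt_iff_of_mem_Xplus {n : ℕ} {i j : Fin n} {x : Equiv.Perm (Fin (n + 1))}
    (hx : x ∈ Xplus ({i}ᶜ : Set (Fin n)) {j}ᶜ) {p q : Fin (n + 1)} (hpq : p < q) :
    x q < x p ↔ (p ≤ j.castSucc ↔ q ≤ j.castSucc) ∨
      ¬ (x p ≤ i.castSucc ∧ ¬ x q ≤ i.castSucc) := by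
  by_cases h : p ≤ j.castSucc ↔ q ≤ j.castSucc
  · simp [h, apply_lt_apply_of_compl_subset_Des hx.2 hpq h]
  · by_cases hi : x p ≤ i.castSucc ↔ x q ≤ i.castSucc
    · have : x q < x p := by
        by_contra hlt
        have hlt' : x p < x q := lt_of_le_of_ne (not_lt.1 hlt) fun e => hpq.ne (x.injective e)
        have := apply_lt_apply_of_compl_subset_Des hx.1 hlt' hi
        simp only [Equiv.Perm.inv_def, Equiv.symm_apply_apply] at this
        exact absurd this hpq.le.not_gt
      grind
    · grind

theorem eq_of_mem_Xplus_of_lowCount_eq {n : ℕ} {i j : Fin n} {x y : Equiv.Perm (Fin (n + 1))}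
    (hx : x ∈ Xplus ({i}ᶜ : Set (Fin n)) {j}ᶜ) (hy : y ∈ Xplus ({i}ᶜ : Set (Fin n)) {j}ᶜ)
    (h : lowCount j.castSucc i.castSucc x = lowCount j.castSucc i.castSucc y) : x = y := by
  have upper : ∀ z ∈ Xplus ({i}ᶜ : Set (Fin n)) {j}ᶜ, ∀ p q, p < q →
      (p ≤ j.castSucc ↔ q ≤ j.castSucc) → z p ≤ i.castSucc → z q ≤ i.castSucc :=
    fun z hz p q hpq hb hp => (apply_lt_apply_of_compl_subset_Des hz.2 hpq hb).le.trans hp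
  have low : ∀ p, x p ≤ i.castSucc ↔ y p ≤ i.castSucc := by
    intro p
    by_cases hp : p ≤ j.castSucc
    · exact filter_iff_of_card_eq (P := fun p => p ≤ j.castSucc)
        (Q := fun p => x p ≤ i.castSucc) (Q' := fun p => y p ≤ i.castSucc)
        (fun p q hpq h1 h2 => upper x hx p q hpq (iff_of_true h1 h2))
        (fun p q hpq h1 h2 => upper y hy p q hpq (iff_of_true h1 h2)) h hp
    · have h1 := lowCount_add_card j.castSucc i.castSucc x
      have h2 := lowCount_add_card j.castSucc i.castSucc y
      exact filter_iff_of_card_eq (P := fun p => ¬ p ≤ j.castSucc)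
        (Q := fun p => x p ≤ i.castSucc) (Q' := fun p => y p ≤ i.castSucc)
        (fun p q hpq h1 h2 => upper x hx p q hpq (iff_of_false h1 h2))
        (fun p q hpq h1 h2 => upper y hy p q hpq (iff_of_false h1 h2)) (by omega) hp
  refine perm_eq_of_lt_iff_lt fun p q hpq => ?_
  rw [lt_iff_of_mem_Xplus hx hpq, lt_iff_of_mem_Xplus hy hpq, low p, low q]

/-- An element of `Xplus` dominates every permutation with at least as many low values in low
positions. -/
theorem bruhatLE_of_lowCount_le {n : ℕ} {i j : Fin n} {y : Equiv.Perm (Fin (n + 1))}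
    (hy : y ∈ Xplus ({i}ᶜ : Set (Fin n)) {j}ᶜ) (z : Equiv.Perm (Fin (n + 1)))
    (h : lowCount j.castSucc i.castSucc y ≤ lowCount j.castSucc i.castSucc z) :
    bruhatLE z y := by
  by_cases hJ : ({j}ᶜ : Set (Fin n)) ⊆ Des z
  · by_cases hI : ({i}ᶜ : Set (Fin n)) ⊆ Des z⁻¹
    · rcases h.eq_or_lt with heq | hlt
      · rw [eq_of_mem_Xplus_of_lowCount_eq hy ⟨hI, hJ⟩ heq]
        exact Relation.ReflTransGen.refl
      · obtain ⟨p, hp⟩ := Finset.card_pos.1 (Nat.zero_lt_of_lt hlt)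
        have h1 := lowCount_add_card j.castSucc i.castSucc y
        have h2 := lowCount_add_card j.castSucc i.castSucc z
        have h3 := card_add_card_high j.castSucc i.castSucc y
        have h4 := card_add_card_high j.castSucc i.castSucc z
        obtain ⟨q, hq⟩ := Finset.card_pos.1 (show 0 < (Finset.univ.filter fun p =>
          ¬ p ≤ j.castSucc ∧ ¬ z p ≤ i.castSucc).card by omega)
        simp only [Finset.mem_filter, Finset.mem_univ, true_and] at hp hq
        have hpq : p < q := hp.1.trans_lt (not_le.1 hq.1)
        have hz : z p < z q := hp.2.trans_lt (not_le.1 hq.2)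
        have hlen := sLen_lt_sLen_mul_swap z hpq hz
        have hle := sLen_le (z * Equiv.swap p q)
        have hcount := lowCount_mul_swap_add_one z hp.1 hq.1 hp.2 hq.2
        exact bruhatLE_of_mul_swap hpq hz (bruhatLE_of_lowCount_le hy _ (by omega))
    · obtain ⟨l, hl, hl'⟩ := Set.not_subset.1 hI
      have hli : l ≠ i := hl
      have hblock : l.castSucc ≤ i.castSucc ↔ l.succ ≤ i.castSucc := by
        simp only [Fin.le_def, Fin.val_succ, Fin.val_castSucc, ne_eq, Fin.ext_iff] at hli ⊢
        omega
      have hpq : z⁻¹ l.castSucc < z⁻¹ l.succ :=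
        lt_of_le_of_ne (not_lt.1 hl') fun e => Fin.castSucc_lt_succ.ne (z⁻¹.injective e)
      have hz : z (z⁻¹ l.castSucc) < z (z⁻¹ l.succ) := by
        simpa only [Equiv.Perm.inv_def, Equiv.apply_symm_apply] using Fin.castSucc_lt_succ
      have hlen := sLen_lt_sLen_mul_swap z hpq hz
      have hle := sLen_le (z * Equiv.swap (z⁻¹ l.castSucc) (z⁻¹ l.succ))
      refine bruhatLE_of_mul_swap hpq hz (bruhatLE_of_lowCount_le hy _ ?_)
      rw [Equiv.mul_swap_eq_swap_mul, Equiv.Perm.inv_def, Equiv.apply_symm_apply,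
        Equiv.apply_symm_apply, lowCount_swap_mul z hblock]
      exact h
  · obtain ⟨l, hl, hl'⟩ := Set.not_subset.1 hJ
    have hlj : l ≠ j := hl
    have hblock : l.castSucc ≤ j.castSucc ↔ l.succ ≤ j.castSucc := by
      simp only [Fin.le_def, Fin.val_succ, Fin.val_castSucc, ne_eq, Fin.ext_iff] at hlj ⊢
      omega
    have hz : z l.castSucc < z l.succ :=
      lt_of_le_of_ne (not_lt.1 hl') fun e => Fin.castSucc_lt_succ.ne (z.injective e)
    have hlen := sLen_lt_sLen_mul_swap z Fin.castSucc_lt_succ hz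
    have hle := sLen_le (z * Equiv.swap l.castSucc l.succ)
    refine bruhatLE_of_mul_swap Fin.castSucc_lt_succ hz (bruhatLE_of_lowCount_le hy _ ?_)
    rw [lowCount_mul_swap z hblock]
    exact h
termination_by (n + 1) * (n + 1) - sLen z
decreasing_by all_goals omega

/-- If `I = R − {s_i}` and `J = R − {s_j}` (both complements singletons),
then `X⁺_{I,J}` is a chain in the Bruhat order. -/
theorem stmt_1 (n : ℕ) (hn : 1 ≤ n) (I J : Set (Fin n))
    (hI : ∃ i : Fin n, I = ({i} : Set (Fin n))ᶜ)
    (hJ : ∃ j : Fin n, J = ({j} : Set (Fin n))ᶜ) :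
    IsChainOn (Xplus I J) := by
  obtain ⟨i, rfl⟩ := hI
  obtain ⟨j, rfl⟩ := hJ
  intro x hx y hy
  rcases le_total (lowCount j.castSucc i.castSucc y) (lowCount j.castSucc i.castSucc x) with h | h
  · exact Or.inl (bruhatLE_of_lowCount_le hy x h)
  · exact Or.inr (bruhatLE_of_lowCount_le hx y h)
end

section
/- Let n ≥ 2 and W = S_{n+1}. If I = R − {s_i} for some 1 ≤ i ≤ n and J = R − {s_j, s_{j+1}} for some 1 ≤ j ≤ n−1, then X⁺_{I,J} is totally ordered by the Bruhat order (it is a chain). -/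
open scoped Classical in
/-- The number of positions `t < k` at which `w` takes a value below `p`. -/
noncomputable def smallCount {m : ℕ} (p : ℕ) (w : Equiv.Perm (Fin m)) (k : ℕ) : ℕ :=
  Nat.count (fun t => ∃ h : t < m, (w ⟨t, h⟩ : ℕ) < p) k

/-- `w` is decreasing on the positions of its values below `p`, and on the positions of its
other values. -/
def DecreasingOnClasses {m : ℕ} (p : ℕ) (w : Equiv.Perm (Fin m)) : Prop :=
  ∀ s t : Fin m, s < t → ((w s : ℕ) < p ↔ (w t : ℕ) < p) → w t < w s

section smallCount

variable {m p : ℕ} {w : Equiv.Perm (Fin m)}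

lemma smallCount_zero : smallCount p w 0 = 0 := by
  simp [smallCount]

lemma smallCount_succ_of_lt {k : ℕ} (hk : k < m) (h : (w ⟨k, hk⟩ : ℕ) < p) :
    smallCount p w (k + 1) = smallCount p w k + 1 := by
  simp only [smallCount, Nat.count_succ]
  rw [if_pos ⟨hk, h⟩]

lemma smallCount_succ_of_le {k : ℕ} (hk : k < m) (h : p ≤ (w ⟨k, hk⟩ : ℕ)) :
    smallCount p w (k + 1) = smallCount p w k := by
  simp only [smallCount, Nat.count_succ]
  rw [if_neg (by rintro ⟨_, hlt⟩; omega), add_zero]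

lemma smallCount_mono : Monotone (smallCount p w) :=
  Nat.count_monotone _

lemma smallCount_succ_le (k : ℕ) : smallCount p w (k + 1) ≤ smallCount p w k + 1 := by
  simp only [smallCount, Nat.count_succ]
  split_ifs <;> omega

lemma smallCount_add_le (k d : ℕ) : smallCount p w (k + d) ≤ smallCount p w k + d := by
  induction d with
  | zero => simp
  | succ d ih =>
    have := smallCount_succ_le (p := p) (w := w) (k + d)
    rw [← add_assoc]
    omega

lemma smallCount_total :
    smallCount p w m = (Finset.univ.filter fun v : Fin m => (v : ℕ) < p).card := by
  classical
  rw [smallCount, Nat.count_eq_card_filter_range]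
  symm
  refine Finset.card_bij (fun v _ => ((w⁻¹ v : Fin m) : ℕ)) ?_ ?_ ?_
  · intro v hv
    simp only [Finset.mem_filter, Finset.mem_univ, true_and] at hv
    simp [hv]
  · intro a _ b _ h
    exact w⁻¹.injective (Fin.ext h)
  · intro t ht
    simp only [Finset.mem_filter, Finset.mem_range] at ht
    obtain ⟨_, h, ht⟩ := ht
    exact ⟨w ⟨t, h⟩, by simpa using ht, by simp⟩

/-- On a block of positions where values below `p` come last, the counts compare as soon as they
compare at both ends of the block. -/
lemma smallCount_le_of_block {x y : Equiv.Perm (Fin m)} {s e : ℕ} (he : e ≤ m)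
    (hy : ∀ t (h : t + 1 < m), s ≤ t → t + 1 < e →
      (y ⟨t, by omega⟩ : ℕ) < p → (y ⟨t + 1, h⟩ : ℕ) < p)
    (hs : smallCount p y s ≤ smallCount p x s) (hee : smallCount p y e ≤ smallCount p x e)
    {k : ℕ} (hsk : s ≤ k) (hke : k ≤ e) : smallCount p y k ≤ smallCount p x k := by
  rcases Nat.eq_or_lt_of_le hsk with rfl | hsk
  · exact hs
  obtain ⟨k, rfl⟩ : ∃ l, k = l + 1 := ⟨k - 1, by omega⟩
  have hkm : k < m := by omega
  by_cases hsmall : (y ⟨k, hkm⟩ : ℕ) < p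
  · have hall : ∀ d (h : k + d < e), (y ⟨k + d, by omega⟩ : ℕ) < p := by
      intro d
      induction d with
      | zero => intro _; exact hsmall
      | succ d ih => intro h; exact hy (k + d) (by omega) (by omega) (by omega) (ih (by omega))
    have hcount : ∀ d, k + d ≤ e → smallCount p y (k + d) = smallCount p y k + d := by
      intro d
      induction d with
      | zero => simp
      | succ d ih =>
        intro h
        have h₁ := smallCount_succ_of_lt (by omega) (hall d (by omega))
        have h₂ := ih (by omega)
        rw [← add_assoc]
        omega
    have h₁ := hcount 1 (by omega)
    have h₂ := hcount (e - k) (by omega)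
    have h₃ := smallCount_add_le (p := p) (w := x) (k + 1) (e - (k + 1))
    rw [show k + (e - k) = e by omega] at h₂
    rw [show k + 1 + (e - (k + 1)) = e by omega] at h₃
    omega
  · have hall : ∀ d, s + d ≤ k → p ≤ (y ⟨k - d, by omega⟩ : ℕ) := by
      intro d
      induction d with
      | zero => intro _; simpa using hsmall
      | succ d ih =>
        intro h
        by_contra! hlt
        have h₁ := hy (k - (d + 1)) (by omega) (by omega) (by omega) hlt
        have h₂ := ih (by omega)
        simp only [show k - (d + 1) + 1 = k - d by omega] at h₁
        omega
    have hcount : ∀ l, s ≤ l → l ≤ k + 1 → smallCount p y l = smallCount p y s := by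
      intro l hl
      induction l, hl using Nat.le_induction with
      | base => simp
      | succ l hl ih =>
        intro h
        have h₁ := hall (k - l) (by omega)
        simp only [show k - (k - l) = l by omega] at h₁
        rw [smallCount_succ_of_le (by omega) h₁, ih (by omega)]
    rw [hcount (k + 1) (by omega) le_rfl]
    exact hs.trans (smallCount_mono (by omega))

end smallCount

lemma swap_lt_swap {m k : ℕ} (hk : k + 1 < m) {s t : Fin m} (hst : s < t)
    (hne : ¬ (s = ⟨k, by omega⟩ ∧ t = ⟨k + 1, hk⟩)) :
    Equiv.swap ⟨k, by omega⟩ ⟨k + 1, hk⟩ s < Equiv.swap ⟨k, by omega⟩ ⟨k + 1, hk⟩ t := by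
  simp only [Equiv.swap_apply_def]
  split_ifs <;> simp only [Fin.ext_iff, Fin.lt_def] at * <;> omega

lemma sLen_mul_swap_lt {m k : ℕ} (hk : k + 1 < m) (y : Equiv.Perm (Fin m))
    (h : y ⟨k + 1, hk⟩ < y ⟨k, by omega⟩) :
    sLen (y * Equiv.swap ⟨k, by omega⟩ ⟨k + 1, hk⟩) < sLen y := by
  set a : Fin m := ⟨k, by omega⟩ with ha
  set b : Fin m := ⟨k + 1, hk⟩ with hb
  have hab : a < b := by simp [ha, hb, Fin.lt_def]
  unfold sLen
  rw [← Finset.card_image_of_injective _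
    ((Equiv.swap a b).injective.prodMap (Equiv.swap a b).injective)]
  refine Finset.card_lt_card (Finset.ssubset_iff_of_subset ?_ |>.2 ⟨(a, b), ?_, ?_⟩)
  · intro q hq
    simp only [Finset.mem_image, Finset.mem_filter, Finset.mem_univ, true_and] at hq
    obtain ⟨⟨s, t⟩, ⟨hst, hinv⟩, rfl⟩ := hq
    simp only [Finset.mem_filter, Finset.mem_univ, true_and, Prod.map]
    refine ⟨swap_lt_swap hk hst ?_, by simpa using hinv⟩
    intro hst_eq
    simp only [Equiv.Perm.mul_apply, show s = a from hst_eq.1, show t = b from hst_eq.2,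
      Equiv.swap_apply_left, Equiv.swap_apply_right] at hinv
    exact absurd hinv (not_lt.2 h.le)
  · simpa using ⟨hab, h⟩
  · simp only [Finset.mem_image, Finset.mem_filter, Finset.mem_univ, true_and, not_exists,
      not_and]
    rintro ⟨s, t⟩ ⟨hst, -⟩ heq
    simp only [Prod.map, Prod.mk.injEq] at heq
    have h₁ : s = b := by rw [← Equiv.swap_apply_self a b s]; simp [heq.1]
    have h₂ : t = a := by rw [← Equiv.swap_apply_self a b t]; simp [heq.2]
    subst h₁ h₂
    exact absurd hst (not_lt.2 hab.le)

namespace DecreasingOnClasses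

variable {m p : ℕ} {x y : Equiv.Perm (Fin m)}

lemma eq_of_smallCount_eq (hx : DecreasingOnClasses p x) (hy : DecreasingOnClasses p y)
    (h : ∀ k, smallCount p x k = smallCount p y k) : x = y := by
  have hiff : ∀ t : Fin m, (x t : ℕ) < p ↔ (y t : ℕ) < p := by
    intro t
    have h₀ := h t
    have h₁ := h (t + 1)
    rcases lt_or_ge (x t : ℕ) p with hxt | hxt <;> rcases lt_or_ge (y t : ℕ) p with hyt | hyt
    · simp [hxt, hyt]
    · rw [smallCount_succ_of_lt t.2 hxt, smallCount_succ_of_le t.2 hyt] at h₁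
      omega
    · rw [smallCount_succ_of_le t.2 hxt, smallCount_succ_of_lt t.2 hyt] at h₁
      omega
    · simp [not_lt.2 hxt, not_lt.2 hyt]
  have hcmp : ∀ s t : Fin m, x s < x t → y s < y t := by
    intro s t hst
    by_cases hc : (x s : ℕ) < p ↔ (x t : ℕ) < p
    · rcases lt_trichotomy s t with hlt | rfl | hlt
      · exact absurd hst (not_lt.2 (hx s t hlt hc).le)
      · exact absurd hst (lt_irrefl _)
      · exact hy t s hlt (by rw [← hiff, ← hiff, hc])
    · have h₁ := hiff s
      have h₂ := hiff t
      rw [Fin.lt_def] at hst ⊢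
      omega
  have hmono : StrictMono (y * x⁻¹ : Equiv.Perm (Fin m)) := by
    intro u v huv
    exact hcmp _ _ (by simpa using huv)
  have hid : (y * x⁻¹ : Equiv.Perm (Fin m)) = 1 := by
    apply Equiv.ext
    intro v
    exact congrFun ((hmono.range_inj strictMono_id).1
      (by rw [Equiv.range_eq_univ, Set.range_id])) v
  exact (mul_inv_eq_one.1 hid).symm

lemma mul_swap (hy : DecreasingOnClasses p y) {k : ℕ} (hk : k + 1 < m)
    (hl : p ≤ (y ⟨k, by omega⟩ : ℕ)) (hs : (y ⟨k + 1, hk⟩ : ℕ) < p) :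
    DecreasingOnClasses p (y * Equiv.swap ⟨k, by omega⟩ ⟨k + 1, hk⟩) := by
  intro s t hst hc
  simp only [Equiv.Perm.mul_apply] at hc ⊢
  refine hy _ _ ?_ hc
  by_cases hne : s = ⟨k, by omega⟩ ∧ t = ⟨k + 1, hk⟩
  · rw [hne.1, hne.2, Equiv.swap_apply_left, Equiv.swap_apply_right] at hc
    omega
  · exact swap_lt_swap hk hst hne

end DecreasingOnClasses

lemma smallCount_mul_swap {m p : ℕ} {y : Equiv.Perm (Fin m)} {k : ℕ} (hk : k + 1 < m) {l : ℕ}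
    (hl : l ≠ k + 1) :
    smallCount p (y * Equiv.swap ⟨k, by omega⟩ ⟨k + 1, hk⟩) l = smallCount p y l := by
  set z := y * Equiv.swap ⟨k, by omega⟩ ⟨k + 1, hk⟩ with hz
  have hzk : z ⟨k, by omega⟩ = y ⟨k + 1, hk⟩ := by simp [hz]
  have hzk' : z ⟨k + 1, hk⟩ = y ⟨k, by omega⟩ := by simp [hz]
  have hzt : ∀ t : ℕ, t ≠ k → t ≠ k + 1 → ∀ h : t < m, z ⟨t, h⟩ = y ⟨t, h⟩ := by
    intro t h₁ h₂ h
    rw [hz, Equiv.Perm.mul_apply, Equiv.swap_apply_of_ne_of_ne] <;> simpa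
  have hstep : ∀ t, t ≠ k → t ≠ k + 1 → smallCount p z t = smallCount p y t →
      smallCount p z (t + 1) = smallCount p y (t + 1) := by
    intro t h₁ h₂ h
    unfold smallCount at h ⊢
    simp only [Nat.count_succ]
    simp +contextual only [h, hzt t h₁ h₂]
  have hle : ∀ t, t ≤ k → smallCount p z t = smallCount p y t := by
    intro t
    induction t with
    | zero => simp [smallCount_zero]
    | succ t ih => intro h; exact hstep t (by omega) (by omega) (ih (by omega))
  rcases Nat.lt_or_ge l (k + 1) with h | h
  · exact hle l (by omega)
  have h : k + 2 ≤ l := by omega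
  clear hl
  induction l, h using Nat.le_induction with
  | base =>
    have h₀ := hle k le_rfl
    unfold smallCount at h₀ ⊢
    simp only [Nat.count_succ, h₀, hk, (Nat.lt_of_succ_lt hk), exists_true_left, hzk, hzk']
    omega
  | succ l hl ih => exact hstep l (by omega) (by omega) (ih (by omega))

/-- Permutations that are decreasing on classes are compared in Bruhat order by their counts. -/
lemma bruhatLE_of_smallCount_le {m p : ℕ} {x : Equiv.Perm (Fin m)}
    (hx : DecreasingOnClasses p x) (y : Equiv.Perm (Fin m)) (hy : DecreasingOnClasses p y)
    (h : ∀ k ≤ m, smallCount p y k ≤ smallCount p x k) : bruhatLE x y := by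
  induction hN : sLen y using Nat.strong_induction_on generalizing y with
  | _ N ih =>
  have htot : smallCount p y m = smallCount p x m := by rw [smallCount_total, smallCount_total]
  by_cases heq : ∀ k ≤ m, smallCount p x k = smallCount p y k
  · have hall : ∀ k, smallCount p x k = smallCount p y k := by
      intro k
      rcases le_total k m with hk | hk
      · exact heq k hk
      · induction k, hk using Nat.le_induction with
        | base => exact htot.symm
        | succ k hk ih =>
          unfold smallCount at ih ⊢
          simp [Nat.count_succ, ih, not_lt.2 hk]
    rw [hx.eq_of_smallCount_eq hy hall]
    exact Relation.ReflTransGen.refl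
  · push Not at heq
    have hex : ∃ k, ∃ hk : k < m, (y ⟨k, hk⟩ : ℕ) < p ∧ smallCount p y k < smallCount p x k := by
      by_contra! hno
      obtain ⟨k₀, hk₀, hne⟩ := heq
      have hgt : ∀ l, k₀ ≤ l → l ≤ m → smallCount p y l < smallCount p x l := by
        intro l hl
        induction l, hl using Nat.le_induction with
        | base => intro _; have := h k₀ hk₀; omega
        | succ l hl ih =>
          intro hlm
          have h₁ := ih (by omega)
          have h₂ : p ≤ (y ⟨l, hlm⟩ : ℕ) := by
            by_contra! hc
            have := hno l hlm hc
            omega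
          rw [smallCount_succ_of_le hlm h₂]
          exact h₁.trans_le (smallCount_mono (by omega))
      have := hgt m hk₀ le_rfl
      omega
    classical
    obtain ⟨hk, hsmall, hlt⟩ := Nat.find_spec hex
    have hmin := fun l => Nat.find_min hex (m := l)
    generalize Nat.find hex = k at hk hsmall hlt hmin
    obtain _ | k := k
    · simp [smallCount_zero] at hlt
    have hlarge : p ≤ (y ⟨k, by omega⟩ : ℕ) := by
      by_contra! hc
      refine hmin k (by omega) ⟨by omega, hc, ?_⟩
      rw [smallCount_succ_of_lt (by omega) hc] at hlt
      have := smallCount_succ_le (p := p) (w := x) k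
      omega
    have hdesc : y ⟨k + 1, hk⟩ < y ⟨k, by omega⟩ := by rw [Fin.lt_def]; omega
    have hlen := sLen_mul_swap_lt hk y hdesc
    refine Relation.ReflTransGen.tail (ih _ (hN ▸ hlen) _ (hy.mul_swap hk hlarge hsmall) ?_ rfl)
      ⟨⟨y ⟨k, by omega⟩, y ⟨k + 1, hk⟩, hdesc.ne', ?_⟩, hlen⟩
    · intro l hl
      rcases eq_or_ne l (k + 1) with rfl | hne
      · have h₁ := smallCount_mul_swap (p := p) (y := y) hk (l := k) (by omega)
        have h₂ := smallCount_succ_le (p := p)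
          (w := y * Equiv.swap ⟨k, by omega⟩ ⟨k + 1, hk⟩) k
        have h₃ := smallCount_succ_of_le (by omega) hlarge
        omega
      · rw [smallCount_mul_swap hk hne]
        exact h l hl
    · rw [Equiv.swap_apply_apply]
      simp [mul_assoc]

lemma decreasingOnClasses_of_compl_subset_Des {n : ℕ} {w : Equiv.Perm (Fin (n + 1))} {i : Fin n}
    (h : ({i} : Set (Fin n))ᶜ ⊆ Des w⁻¹) : DecreasingOnClasses ((i : ℕ) + 1) w := by
  have hinv : ∀ u v (hu : u < n + 1) (hv : v < n + 1), u < v →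
      (u < (i : ℕ) + 1 ↔ v < (i : ℕ) + 1) → w⁻¹ ⟨v, hv⟩ < w⁻¹ ⟨u, hu⟩ := by
    intro u v hu hv huv
    induction v, (show u + 1 ≤ v from huv) using Nat.le_induction with
    | base =>
      intro hc
      exact h (show (⟨u, by omega⟩ : Fin n) ∈ _ by
        simp only [Set.mem_compl_iff, Set.mem_singleton_iff, Fin.ext_iff]; omega)
    | succ v huv' ih =>
      intro hc
      have h₁ := ih (by omega) huv' (by omega)
      have h₂ := h (show (⟨v, by omega⟩ : Fin n) ∈ _ by
        simp only [Set.mem_compl_iff, Set.mem_singleton_iff, Fin.ext_iff]; omega)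
      exact lt_trans h₂ h₁
  intro s t hst hc
  by_contra! hle
  have hne : w s ≠ w t := fun he => hst.ne (w.injective he)
  have := hinv (w s) (w t) (w s).2 (w t).2 (Fin.lt_def.1 (lt_of_le_of_ne hle hne)) hc
  simp only [Fin.eta, Equiv.Perm.coe_inv, Equiv.symm_apply_apply] at this
  exact absurd hst (not_lt.2 this.le)

/-- If `I = R − {s_i}` (1 ≤ i ≤ n) and `J = R − {s_j, s_{j+1}}` (1 ≤ j ≤ n−1),
then `X⁺_{I,J}` is a chain in the Bruhat order.  (Indices of simple reflections
are 0-based: `i : Fin n` stands for `s_{i+1}`.) -/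
theorem stmt_2 (n : ℕ) (hn : 2 ≤ n) (I J : Set (Fin n))
    (hI : ∃ i : Fin n, I = ({i} : Set (Fin n))ᶜ)
    (hJ : ∃ j : Fin n, ∃ h : (j : ℕ) + 1 < n,
      J = ({j, ⟨(j : ℕ) + 1, h⟩} : Set (Fin n))ᶜ) :
    IsChainOn (Xplus I J) := by
  obtain ⟨i, rfl⟩ := hI
  obtain ⟨j, hj, rfl⟩ := hJ
  have hstep : ∀ y ∈ Xplus ({i} : Set (Fin n))ᶜ ({j, ⟨(j : ℕ) + 1, hj⟩} : Set (Fin n))ᶜ,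
      ∀ t (h : t + 1 < n + 1), t ≠ j → t ≠ (j : ℕ) + 1 →
      (y ⟨t, by omega⟩ : ℕ) < (i : ℕ) + 1 → (y ⟨t + 1, h⟩ : ℕ) < (i : ℕ) + 1 := by
    intro y hy t h h₁ h₂ hlt
    have hd : y ⟨t + 1, h⟩ < y ⟨t, by omega⟩ := hy.2 (show (⟨t, by omega⟩ : Fin n) ∈ _ by
      simp [Fin.ext_iff, h₁, h₂])
    exact lt_trans hd hlt
  have key : ∀ x ∈ Xplus ({i} : Set (Fin n))ᶜ ({j, ⟨(j : ℕ) + 1, hj⟩} : Set (Fin n))ᶜ,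
      ∀ y ∈ Xplus ({i} : Set (Fin n))ᶜ ({j, ⟨(j : ℕ) + 1, hj⟩} : Set (Fin n))ᶜ,
      smallCount ((i : ℕ) + 1) y (j + 1) ≤ smallCount ((i : ℕ) + 1) x (j + 1) →
      smallCount ((i : ℕ) + 1) y (j + 2) ≤ smallCount ((i : ℕ) + 1) x (j + 2) →
      bruhatLE x y := by
    intro x hx y hy h₁ h₂
    refine bruhatLE_of_smallCount_le (decreasingOnClasses_of_compl_subset_Des hx.1) y
      (decreasingOnClasses_of_compl_subset_Des hy.1) fun k hk => ?_
    rcases Nat.lt_or_ge (j + 1) k with hjk | hjk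
    · refine smallCount_le_of_block (s := j + 2) (e := n + 1) le_rfl ?_ h₂ ?_ hjk hk
      · exact fun t h _ _ => hstep y hy t h (by omega) (by omega)
      · rw [smallCount_total, smallCount_total]
    · refine smallCount_le_of_block (s := 0) (e := j + 1) (by omega) ?_ ?_ h₁ k.zero_le hjk
      · exact fun t h _ _ => hstep y hy t h (by omega) (by omega)
      · simp [smallCount_zero]
  intro x hx y hy
  have hx₁ := smallCount_succ_le (p := (i : ℕ) + 1) (w := x) (j + 1)
  have hy₁ := smallCount_succ_le (p := (i : ℕ) + 1) (w := y) (j + 1)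
  have hx₂ := smallCount_mono (p := (i : ℕ) + 1) (w := x) (Nat.le_succ ((j : ℕ) + 1))
  have hy₂ := smallCount_mono (p := (i : ℕ) + 1) (w := y) (Nat.le_succ ((j : ℕ) + 1))
  simp only [Nat.succ_eq_add_one, add_assoc, Nat.reduceAdd] at hx₁ hx₂ hy₁ hy₂
  by_cases hc : smallCount ((i : ℕ) + 1) y (j + 1) ≤ smallCount ((i : ℕ) + 1) x (j + 1) ∧
      smallCount ((i : ℕ) + 1) y (j + 2) ≤ smallCount ((i : ℕ) + 1) x (j + 2)
  · exact Or.inl (key x hx y hy hc.1 hc.2)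
  · exact Or.inr (key y hy x hx (by omega) (by omega))
end

section
/- Let n ≥ 1 and W = S_{n+1}. If I = R − {s_1} or I = R − {s_n}, then for every subset J ⊆ R, the set X⁺_{I,J} is totally ordered by the Bruhat order (it is a chain). -/
theorem swap_castSucc_succ_lt_iff {n : ℕ} (k : Fin n) {p q : Fin (n + 1)}
    (h : ¬(p = k.castSucc ∧ q = k.succ)) (h' : ¬(p = k.succ ∧ q = k.castSucc)) :
    Equiv.swap k.castSucc k.succ p < Equiv.swap k.castSucc k.succ q ↔ p < q := by
  simp only [Equiv.swap_apply_def]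
  simp only [Fin.ext_iff, Fin.val_castSucc, Fin.val_succ] at *
  split_ifs <;> simp only [Fin.lt_def, Fin.val_castSucc, Fin.val_succ] <;> omega

theorem sLen_lt_mul_swap {n : ℕ} (w : Equiv.Perm (Fin (n + 1))) (k : Fin n)
    (h : w k.castSucc < w k.succ) :
    sLen w < sLen (w * Equiv.swap k.castSucc k.succ) := by
  set s := Equiv.swap k.castSucc k.succ with hs
  unfold sLen
  rw [← Finset.card_map (s.prodCongr s).toEmbedding]
  apply Finset.card_lt_card
  rw [Finset.ssubset_iff_of_subset]
  · refine ⟨(k.castSucc, k.succ), by simp [hs, h], ?_⟩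
    simp only [Finset.mem_map, Finset.mem_filter, not_exists, not_and]
    rintro ⟨p, q⟩ ⟨-, hpq, -⟩ he
    simp only [Equiv.coe_toEmbedding, Equiv.prodCongr_apply, Prod.map_apply, Prod.mk.injEq] at he
    have hp : p = k.succ := by rw [← s.symm_apply_apply p, he.1]; simp [hs]
    have hq : q = k.castSucc := by rw [← s.symm_apply_apply q, he.2]; simp [hs]
    subst hp hq
    exact absurd hpq (not_lt.2 k.castSucc_lt_succ.le)
  · intro x hx
    simp only [Finset.mem_map, Finset.mem_filter] at hx
    obtain ⟨⟨p, q⟩, ⟨-, hpq, hw⟩, rfl⟩ := hx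
    dsimp only at hpq hw
    refine Finset.mem_filter.2 ⟨Finset.mem_univ _,
      (swap_castSucc_succ_lt_iff k ?_ ?_).2 hpq, by simpa [hs] using hw⟩
    · rintro ⟨rfl, rfl⟩
      exact lt_asymm h hw
    · rintro ⟨rfl, rfl⟩
      exact absurd hpq (not_lt.2 k.castSucc_lt_succ.le)

theorem bruhatLE_mul_swap {n : ℕ} (w : Equiv.Perm (Fin (n + 1))) (k : Fin n)
    (h : w k.castSucc < w k.succ) :
    bruhatLE w (w * Equiv.swap k.castSucc k.succ) :=
  .single ⟨⟨_, _, h.ne, Equiv.mul_swap_eq_swap_mul ..⟩, sLen_lt_mul_swap w k h⟩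

theorem mul_swap_bruhatLE {n : ℕ} (w : Equiv.Perm (Fin (n + 1))) (k : Fin n)
    (h : w k.succ < w k.castSucc) :
    bruhatLE (w * Equiv.swap k.castSucc k.succ) w := by
  simpa [mul_assoc] using bruhatLE_mul_swap (w * Equiv.swap k.castSucc k.succ) k (by simpa using h)

/-- All values of `w` other than `a` appear in decreasing order. -/
def AntiOff {n : ℕ} (a : Fin (n + 1)) (w : Equiv.Perm (Fin (n + 1))) : Prop :=
  StrictAnti fun i => w⁻¹ (a.succAbove i)

theorem AntiOff.eq_of_inv_apply_eq {n : ℕ} {a : Fin (n + 1)} {x y : Equiv.Perm (Fin (n + 1))}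
    (hx : AntiOff a x) (hy : AntiOff a y) (h : x⁻¹ a = y⁻¹ a) : x = y := by
  have range_eq (w : Equiv.Perm (Fin (n + 1))) :
      Set.range (fun i => w⁻¹ (a.succAbove i)) = {w⁻¹ a}ᶜ := by
    rw [← Function.comp_def, Set.range_comp, Fin.range_succAbove, Set.image_compl_eq w⁻¹.bijective,
      Set.image_singleton]
  have hf : (fun i => x⁻¹ (a.succAbove i)) = fun i => y⁻¹ (a.succAbove i) := by
    have := (StrictMono.range_inj (f := fun i => OrderDual.toDual (x⁻¹ (a.succAbove i)))
      (g := fun i => OrderDual.toDual (y⁻¹ (a.succAbove i))) hx hy).1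
      (((range_eq x).trans (by rw [h])).trans (range_eq y).symm)
    exact this
  refine inv_injective (Equiv.ext fun b => ?_)
  rcases eq_or_ne b a with rfl | hb
  · exact h
  · obtain ⟨i, rfl⟩ := Fin.exists_succAbove_eq hb
    exact congrFun hf i

theorem AntiOff.mul_swap {n : ℕ} {a : Fin (n + 1)} {w : Equiv.Perm (Fin (n + 1))}
    (hw : AntiOff a w) {k : Fin n} (hk : w k.castSucc = a) :
    AntiOff a (w * Equiv.swap k.castSucc k.succ) := by
  have ne (i : Fin n) : w⁻¹ (a.succAbove i) ≠ k.castSucc := by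
    rw [Ne, Equiv.Perm.inv_eq_iff_eq, hk]
    exact Fin.succAbove_ne a i
  intro i j hij
  simp only [mul_inv_rev, Equiv.swap_inv, Equiv.Perm.mul_apply]
  exact (swap_castSucc_succ_lt_iff k (fun h => ne _ h.1) (fun h => ne _ h.2)).2 (hw hij)

theorem AntiOff.rel_of_inv_apply_le {n : ℕ} {a : Fin (n + 1)}
    {r : Equiv.Perm (Fin (n + 1)) → Equiv.Perm (Fin (n + 1)) → Prop}
    (hrefl : ∀ x, r x x) (htrans : ∀ {x y z}, r x y → r y z → r x z)
    (hstep : ∀ (w : Equiv.Perm (Fin (n + 1))) (k : Fin n), w k.castSucc = a →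
      r w (w * Equiv.swap k.castSucc k.succ))
    {x y : Equiv.Perm (Fin (n + 1))} (hx : AntiOff a x) (hy : AntiOff a y)
    (h : x⁻¹ a ≤ y⁻¹ a) : r x y := by
  obtain ⟨d, hd⟩ := Nat.exists_eq_add_of_le (Fin.le_def.1 h)
  clear h
  induction d generalizing x with
  | zero => exact hx.eq_of_inv_apply_eq hy (Fin.ext hd.symm) ▸ hrefl x
  | succ d ih =>
    have hlt : (x⁻¹ a : ℕ) < n := by have := (y⁻¹ a).isLt; omega
    obtain ⟨k, hk⟩ : ∃ k : Fin n, k.castSucc = x⁻¹ a := ⟨⟨_, hlt⟩, rfl⟩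
    have hxk : x k.castSucc = a := by simp [hk]
    refine htrans (hstep x k hxk) (ih (hx.mul_swap hxk) ?_)
    have : (x * Equiv.swap k.castSucc k.succ)⁻¹ a = k.succ := by
      rw [Equiv.Perm.inv_eq_iff_eq]
      simp [hxk]
    rw [this, hd, ← hk, Fin.val_succ, Fin.val_castSucc]
    omega

theorem AntiOff.bruhatLE_zero {n : ℕ} {x y : Equiv.Perm (Fin (n + 1))} (hx : AntiOff 0 x)
    (hy : AntiOff 0 y) (h : x⁻¹ 0 ≤ y⁻¹ 0) : bruhatLE x y := by
  refine rel_of_inv_apply_le (fun _ => .refl) (fun h h' => h.trans h') (fun w k hk => ?_) hx hy h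
  refine bruhatLE_mul_swap w k (hk ▸ Fin.pos_iff_ne_zero.2 ?_)
  rw [← hk]
  exact w.injective.ne k.castSucc_lt_succ.ne'

theorem AntiOff.bruhatLE_last {n : ℕ} {x y : Equiv.Perm (Fin (n + 1))}
    (hx : AntiOff (Fin.last n) x) (hy : AntiOff (Fin.last n) y)
    (h : x⁻¹ (Fin.last n) ≤ y⁻¹ (Fin.last n)) : bruhatLE y x := by
  refine rel_of_inv_apply_le (r := fun x y => bruhatLE y x) (fun _ => .refl)
    (fun h h' => Relation.ReflTransGen.trans h' h) (fun w k hk => ?_) hx hy h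
  refine mul_swap_bruhatLE w k (hk ▸ Fin.lt_last_iff_ne_last.2 ?_)
  rw [← hk]
  exact w.injective.ne k.castSucc_lt_succ.ne'

theorem antiOff_zero_of_subset_Des {m : ℕ} {w : Equiv.Perm (Fin (m + 2))}
    (h : ({0} : Set (Fin (m + 1)))ᶜ ⊆ Des w⁻¹) : AntiOff 0 w := by
  refine Fin.strictAnti_iff_succ_lt.2 fun i => ?_
  simp only [Fin.succAbove_zero]
  exact h (Fin.succ_ne_zero i)

theorem antiOff_last_of_subset_Des {m : ℕ} {w : Equiv.Perm (Fin (m + 2))}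
    (h : ({Fin.last m} : Set (Fin (m + 1)))ᶜ ⊆ Des w⁻¹) : AntiOff (Fin.last (m + 1)) w := by
  refine Fin.strictAnti_iff_succ_lt.2 fun i => ?_
  simp only [Fin.succAbove_last]
  exact h (Fin.castSucc_lt_last i).ne

/-- If `I = R − {s_1}` or `I = R − {s_n}`, then for every `J ⊆ R` the set
`X⁺_{I,J}` is a chain in the Bruhat order. -/
theorem stmt_3 (n : ℕ) (hn : 1 ≤ n) (I : Set (Fin n))
    (hI : I = ({⟨0, by omega⟩} : Set (Fin n))ᶜ ∨ I = ({⟨n - 1, by omega⟩} : Set (Fin n))ᶜ) :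
    ∀ J : Set (Fin n), IsChainOn (Xplus I J) := by
  obtain ⟨m, rfl⟩ : ∃ m, n = m + 1 := ⟨n - 1, by omega⟩
  intro J x hx y hy
  rcases hI with rfl | rfl
  · have hx' := antiOff_zero_of_subset_Des hx.1
    have hy' := antiOff_zero_of_subset_Des hy.1
    exact (le_total (x⁻¹ 0) (y⁻¹ 0)).imp (hx'.bruhatLE_zero hy') (hy'.bruhatLE_zero hx')
  · have hx' := antiOff_last_of_subset_Des hx.1
    have hy' := antiOff_last_of_subset_Des hy.1
    exact (le_total (y⁻¹ (Fin.last _)) (x⁻¹ (Fin.last _))).imp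
      (hy'.bruhatLE_last hx') (hx'.bruhatLE_last hy')
end

section
/- Let n ≥ 5 and W = S_{n+1}. Let I = R − {s_2} or I = R − {s_{n−1}}, and let J = R − {s_p, s_q} with 1 < p, p+1 < q, and q < n. Then X⁺_{I,J}, with the restriction of the Bruhat order, has exactly 6 elements and is order-isomorphic to the 'stretched diamond' poset on {0,1,2,3,4,5} whose covering relations are 0 ⋖ 1, 1 ⋖ 2, 1 ⋖ 3, 2 ⋖ 4, 3 ⋖ 4, 4 ⋖ 5 (where 2 and 3 are incomparable). In particular, X⁺_{I,J} is a lattice. -/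
/-- Multiplying on the right by the transposition of two positions `s < t` whose values increase
increases the number of inversions. -/
theorem sLen_lt_sLen_mul_swap_s5 {m : ℕ} (x : Equiv.Perm (Fin m)) {s t : Fin m} (hst : s < t)
    (hx : x s < x t) : sLen x < sLen (x * Equiv.swap s t) := by
  classical
  let f : Fin m × Fin m → Fin m × Fin m := fun r =>
    if Equiv.swap s t r.1 < Equiv.swap s t r.2 then (Equiv.swap s t r.1, Equiv.swap s t r.2) else r
  have hf : Set.InjOn f {r | r.1 < r.2} := by
    rintro ⟨a, b⟩ hab ⟨c, d⟩ hcd h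
    simp only [f, Set.mem_ofPred_eq] at hab hcd h
    split_ifs at h with h1 h2 h2
    · simpa using h
    · simp only [Prod.mk.injEq] at h
      rw [← h.1, ← h.2] at h2
      simp [hab] at h2
    · simp only [Prod.mk.injEq] at h
      rw [h.1, h.2] at h1
      simp [hcd] at h1
    · exact h
  unfold sLen
  set A := Finset.univ.filter fun r : Fin m × Fin m => r.1 < r.2 ∧ x r.2 < x r.1 with hA
  set B := Finset.univ.filter fun r : Fin m × Fin m =>
    r.1 < r.2 ∧ (x * Equiv.swap s t) r.2 < (x * Equiv.swap s t) r.1 with hB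
  have hcard : (A.image f).card = A.card :=
    Finset.card_image_of_injOn (hf.mono fun r hr => by simp [hA] at hr; exact hr.1)
  rw [← hcard]
  refine Finset.card_lt_card (Finset.ssubset_iff_of_subset ?_ |>.2 ⟨(s, t), ?_, ?_⟩)
  · intro r hr
    obtain ⟨⟨a, b⟩, hab, rfl⟩ := Finset.mem_image.1 hr
    simp only [hA, Finset.mem_filter, Finset.mem_univ, true_and] at hab
    refine Finset.mem_filter.2 ⟨Finset.mem_univ _, ?_⟩
    simp only [f, Equiv.Perm.mul_apply]
    split_ifs with h
    · exact ⟨h, by simpa using hab.2⟩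
    · refine ⟨hab.1, ?_⟩
      simp only [Equiv.swap_apply_def] at h ⊢
      grind
  · exact Finset.mem_filter.2 ⟨Finset.mem_univ _, hst, by simpa using hx⟩
  · intro h
    obtain ⟨⟨a, b⟩, hab, h⟩ := Finset.mem_image.1 h
    simp only [hA, Finset.mem_filter, Finset.mem_univ, true_and] at hab
    simp only [f] at h
    split_ifs at h with h1
    · simp only [Prod.mk.injEq, Equiv.swap_apply_eq_iff] at h
      simp only [Equiv.swap_apply_left, Equiv.swap_apply_right] at h
      exact absurd hab.1 (by rw [h.1, h.2]; exact hst.asymm)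
    · simp only [Prod.mk.injEq] at h
      rw [h.1, h.2] at hab
      exact hab.2.asymm hx

theorem bruhatLE_mul_swap_s5 {m : ℕ} (x : Equiv.Perm (Fin m)) {s t : Fin m} (hst : s < t)
    (hx : x s < x t) : bruhatLE x (x * Equiv.swap s t) :=
  .single ⟨⟨x s, x t, hx.ne, Equiv.mul_swap_eq_swap_mul x s t⟩, sLen_lt_sLen_mul_swap_s5 x hst hx⟩

/-- A length-increasing left multiplication by a transposition exchanges two increasing values. -/
theorem exists_eq_mul_swap {m : ℕ} {x y : Equiv.Perm (Fin m)}
    (h : (∃ a b : Fin m, a ≠ b ∧ y = Equiv.swap a b * x) ∧ sLen x < sLen y) :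
    ∃ s t, s < t ∧ x s < x t ∧ y = x * Equiv.swap s t := by
  obtain ⟨⟨a, b, hab, rfl⟩, hl⟩ := h
  wlog hlt : x⁻¹ a < x⁻¹ b generalizing a b
  · rw [Equiv.swap_comm] at hl ⊢
    have hne : x⁻¹ a ≠ x⁻¹ b := fun h => hab (x⁻¹.injective h)
    exact this b a hab.symm hl (lt_of_le_of_ne (not_lt.1 hlt) hne.symm)
  have hy : Equiv.swap a b * x = x * Equiv.swap (x⁻¹ a) (x⁻¹ b) := by
    rw [Equiv.mul_swap_eq_swap_mul]; simp
  refine ⟨x⁻¹ a, x⁻¹ b, hlt, ?_, hy⟩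
  by_contra hcon
  have hba : x (x⁻¹ b) < x (x⁻¹ a) :=
    lt_of_le_of_ne (not_lt.1 hcon) (by simpa using hab.symm)
  have := sLen_lt_sLen_mul_swap_s5 (x * Equiv.swap (x⁻¹ a) (x⁻¹ b)) hlt (by simpa using hba)
  rw [mul_assoc, Equiv.swap_mul_self, mul_one, ← hy] at this
  exact this.asymm hl

/-- The rank functions `#{x < k | w x < l}` are antitone for the Bruhat order. -/
theorem card_filter_le_of_bruhatLE {m : ℕ} {u v : Equiv.Perm (Fin m)} (h : bruhatLE u v)
    (k l : ℕ) :
    (Finset.univ.filter fun x : Fin m => (x : ℕ) < k ∧ (v x : ℕ) < l).card ≤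
      (Finset.univ.filter fun x : Fin m => (x : ℕ) < k ∧ (u x : ℕ) < l).card := by
  classical
  induction h with
  | refl => rfl
  | @tail y z _ h ih =>
    refine le_trans ?_ ih
    obtain ⟨s, t, hst, hy, rfl⟩ := exists_eq_mul_swap h
    have hst' : (s : ℕ) < t := hst
    have hy' : (y s : ℕ) < y t := hy
    refine Finset.card_le_card_of_injOn (fun x => if x = t ∧ l ≤ (y t : ℕ) then s else x) ?_ ?_
    · intro x hx
      simp only [Finset.coe_filter, Finset.mem_univ, true_and, Set.mem_ofPred_eq,
        Equiv.Perm.mul_apply, Equiv.swap_apply_def] at hx ⊢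
      grind
    · intro x hx x' hx' hxx
      have hx := (Finset.mem_filter.1 (Finset.mem_coe.1 hx)).2
      have hx' := (Finset.mem_filter.1 (Finset.mem_coe.1 hx')).2
      simp only [Equiv.Perm.mul_apply, Equiv.swap_apply_def] at hx hx' hxx
      grind

/-- The one-line word with `1` in position `i`, `0` in position `j`, and the other values in
decreasing order. -/
def twoSmallFun (n i j : ℕ) (hij : i < j) (hj : j ≤ n) (x : Fin (n + 1)) : Fin (n + 1) :=
  ⟨if (x : ℕ) = i then 1 else if (x : ℕ) = j then 0 else
    n - x + (if i < x then 1 else 0) + (if j < x then 1 else 0), by split_ifs <;> omega⟩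

theorem twoSmallFun_injective (n i j : ℕ) (hij : i < j) (hj : j ≤ n) :
    Function.Injective (twoSmallFun n i j hij hj) := by
  intro x y h
  have h := congrArg Fin.val h
  simp only [twoSmallFun] at h
  ext
  split_ifs at h <;> omega

/-- The permutation with one-line word `twoSmallFun n i j`. -/
noncomputable def twoSmall (n i j : ℕ) (hij : i < j) (hj : j ≤ n) : Equiv.Perm (Fin (n + 1)) :=
  Equiv.ofBijective _ (Finite.injective_iff_bijective.1 (twoSmallFun_injective n i j hij hj))

theorem twoSmall_apply (n i j : ℕ) (hij : i < j) (hj : j ≤ n) (x : Fin (n + 1)) :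
    (twoSmall n i j hij hj x : ℕ) = if (x : ℕ) = i then 1 else if (x : ℕ) = j then 0 else
      n - x + (if i < x then 1 else 0) + (if j < x then 1 else 0) := rfl

theorem bruhatLE_twoSmall_succ_left (n i j : ℕ) (hij : i + 1 < j) (hj : j ≤ n) :
    bruhatLE (twoSmall n i j (by omega) hj) (twoSmall n (i + 1) j hij hj) := by
  have h : twoSmall n (i + 1) j hij hj = twoSmall n i j (by omega) hj *
      Equiv.swap ⟨i, by omega⟩ ⟨i + 1, by omega⟩ := by
    ext x
    simp only [Equiv.Perm.mul_apply, Equiv.swap_apply_def, twoSmall_apply, Fin.ext_iff]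
    split_ifs <;> simp_all <;> omega
  rw [h]
  refine bruhatLE_mul_swap_s5 _ (by simp) ?_
  simp only [Fin.lt_def, twoSmall_apply]
  split_ifs <;> omega

theorem bruhatLE_twoSmall_succ_right (n i j : ℕ) (hij : i < j) (hj : j + 1 ≤ n) :
    bruhatLE (twoSmall n i j hij (by omega)) (twoSmall n i (j + 1) (by omega) hj) := by
  have h : twoSmall n i (j + 1) (by omega) hj = twoSmall n i j hij (by omega) *
      Equiv.swap ⟨j, by omega⟩ ⟨j + 1, by omega⟩ := by
    ext x
    simp only [Equiv.Perm.mul_apply, Equiv.swap_apply_def, twoSmall_apply, Fin.ext_iff]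
    split_ifs <;> simp_all <;> omega
  rw [h]
  refine bruhatLE_mul_swap_s5 _ (by simp) ?_
  simp only [Fin.lt_def, twoSmall_apply]
  split_ifs <;> omega

theorem bruhatLE_twoSmall_iff {n i j i' j' : ℕ} (hij : i < j) (hj : j ≤ n) (hij' : i' < j')
    (hj' : j' ≤ n) :
    bruhatLE (twoSmall n i j hij hj) (twoSmall n i' j' hij' hj') ↔ i ≤ i' ∧ j ≤ j' := by
  constructor
  · intro h
    constructor
    · have hc := card_filter_le_of_bruhatLE h (i' + 1) 2
      have hpos : 0 < (Finset.univ.filter fun x : Fin (n + 1) =>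
          (x : ℕ) < i' + 1 ∧ (twoSmall n i' j' hij' hj' x : ℕ) < 2).card :=
        Finset.card_pos.2 ⟨⟨i', by omega⟩, by simp [twoSmall_apply]⟩
      obtain ⟨x, hx⟩ := Finset.card_pos.1 (hpos.trans_le hc)
      have hx := (Finset.mem_filter.1 hx).2
      simp only [twoSmall_apply] at hx
      split_ifs at hx <;> omega
    · by_contra hjj
      have hc := card_filter_le_of_bruhatLE h (j' + 1) 2
      have h2 : 1 < (Finset.univ.filter fun x : Fin (n + 1) =>
          (x : ℕ) < j' + 1 ∧ (twoSmall n i' j' hij' hj' x : ℕ) < 2).card := by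
        refine Finset.one_lt_card.2 ⟨⟨i', by omega⟩, ?_, ⟨j', by omega⟩, ?_, ?_⟩
        · simp [twoSmall_apply]; omega
        · simp [twoSmall_apply]; split_ifs <;> omega
        · simp; omega
      obtain ⟨x, hx, y, hy, hxy⟩ := Finset.one_lt_card.1 (h2.trans_le hc)
      have hx := (Finset.mem_filter.1 hx).2
      have hy := (Finset.mem_filter.1 hy).2
      simp only [twoSmall_apply] at hx hy
      refine hxy (Fin.ext ?_)
      split_ifs at hx hy <;> omega
  · rintro ⟨hi, hjj⟩
    have h1 : ∀ k (hk : j ≤ k) (hkn : k ≤ n),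
        bruhatLE (twoSmall n i j hij hj) (twoSmall n i k (by omega) hkn) := by
      intro k hk
      induction k, hk using Nat.le_induction with
      | base => exact fun _ => .refl
      | succ k hk ih =>
        exact fun hkn => (ih (by omega)).trans (bruhatLE_twoSmall_succ_right n i k (by omega) hkn)
    have h2 : ∀ k (hk : i ≤ k) (hkj : k < j'),
        bruhatLE (twoSmall n i j' (by omega) hj') (twoSmall n k j' hkj hj') := by
      intro k hk
      induction k, hk using Nat.le_induction with
      | base => exact fun _ => .refl
      | succ k hk ih =>
        exact fun hkj => (ih (by omega)).trans (bruhatLE_twoSmall_succ_left n k j' hkj hj')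
    exact (h1 j' hjj hj').trans (h2 i' hi hij')

theorem subset_Des_inv_twoSmall (n i j : ℕ) (hij : i < j) (hj : j ≤ n) {k : Fin n}
    (hk : (k : ℕ) ≠ 1) : k ∈ Des (twoSmall n i j hij hj)⁻¹ := by
  set w := twoSmall n i j hij hj with hw
  have h1 : (w (w⁻¹ k.succ) : ℕ) = k + 1 := by simp
  have h2 : (w (w⁻¹ k.castSucc) : ℕ) = k := by simp
  change w⁻¹ k.succ < w⁻¹ k.castSucc
  generalize w⁻¹ k.succ = s at *
  generalize w⁻¹ k.castSucc = t at *
  rw [hw, twoSmall_apply] at h1 h2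
  rw [Fin.lt_def]
  split_ifs at h1 h2 <;> omega

/-- A permutation whose inverse descends at every index other than `1` is determined by the
positions of the values `0` and `1`. -/
theorem exists_eq_twoSmall {n : ℕ} (hn : 2 ≤ n) (w : Equiv.Perm (Fin (n + 1)))
    (hw : ∀ k : Fin n, (k : ℕ) ≠ 1 → k ∈ Des w⁻¹) :
    ∃ (i j : ℕ) (hij : i < j) (hj : j ≤ n), w = twoSmall n i j hij hj := by
  have hlt : w⁻¹ ⟨1, by omega⟩ < w⁻¹ ⟨0, by omega⟩ := hw ⟨0, by omega⟩ (by simp)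
  refine ⟨w⁻¹ ⟨1, by omega⟩, w⁻¹ ⟨0, by omega⟩, hlt, by omega, ?_⟩
  set v := twoSmall n (w⁻¹ ⟨1, by omega⟩) (w⁻¹ ⟨0, by omega⟩) hlt (by omega) with hv
  have hv0 : v⁻¹ ⟨0, by omega⟩ = w⁻¹ ⟨0, by omega⟩ := by
    rw [Equiv.Perm.inv_eq_iff_eq]; ext
    simp [hv, twoSmall_apply]; intro h; exact absurd (Fin.ext h) hlt.ne'
  have hv1 : v⁻¹ ⟨1, by omega⟩ = w⁻¹ ⟨1, by omega⟩ := by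
    rw [Equiv.Perm.inv_eq_iff_eq]; ext
    simp [hv, twoSmall_apply]
  have hanti : ∀ u : Equiv.Perm (Fin (n + 1)), (∀ k : Fin n, (k : ℕ) ≠ 1 → k ∈ Des u⁻¹) →
      StrictAnti fun a : Fin (n - 1) => u⁻¹ ⟨a + 2, by omega⟩ := by
    intro u hu
    obtain ⟨m, rfl⟩ : ∃ m, n = m + 2 := ⟨n - 2, by omega⟩
    refine Fin.strictAnti_iff_succ_lt.2 fun a => ?_
    exact hu ⟨a + 2, by omega⟩ (by simp)
  have hrange : ∀ u : Equiv.Perm (Fin (n + 1)),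
      Set.range (fun a : Fin (n - 1) => u⁻¹ ⟨a + 2, by omega⟩) =
        {u⁻¹ ⟨0, by omega⟩, u⁻¹ ⟨1, by omega⟩}ᶜ := by
    intro u
    ext y
    obtain ⟨z, rfl⟩ := u⁻¹.surjective y
    simp only [Set.mem_range, EmbeddingLike.apply_eq_iff_eq, Set.mem_compl_iff,
      Set.mem_insert_iff, Set.mem_singleton_iff, Fin.ext_iff]
    constructor
    · rintro ⟨a, ha⟩; omega
    · intro h; exact ⟨⟨z - 2, by omega⟩, by simp; omega⟩
  have hEq : (fun a : Fin (n - 1) => w⁻¹ ⟨a + 2, by omega⟩) =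
      fun a : Fin (n - 1) => v⁻¹ ⟨a + 2, by omega⟩ := by
    have hvanti := hanti v fun k hk => subset_Des_inv_twoSmall _ _ _ _ _ hk
    have := (hanti w hw).dual_left.range_inj hvanti.dual_left
    have h2 := this.1 ?_
    · funext a; exact congrFun h2 (OrderDual.toDual a)
    · have e1 := hrange w
      have e2 := hrange v
      rw [hv0, hv1, ← e1] at e2
      exact e2.symm
  rw [← inv_inj]
  ext1 z
  rcases z with ⟨_ | _ | z, hz⟩
  · exact hv0.symm
  · exact hv1.symm
  · exact congrFun hEq ⟨z, by omega⟩

/-- The positions of the values `1` and `0` in the six elements of `X⁺_{I,J}`. -/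
def smallPos (n p q : ℕ) : Fin 6 → ℕ × ℕ :=
  ![(p - 1, p), (p, q), (q - 1, q), (p, n), (q, n), (n - 1, n)]

theorem smallPos_spec {n p q : ℕ} (hp : 0 < p) (hpq : p + 1 < q) (hq : q + 1 < n) (a : Fin 6) :
    (smallPos n p q a).1 < (smallPos n p q a).2 ∧ (smallPos n p q a).2 ≤ n := by
  fin_cases a <;> simp [smallPos] <;> omega

theorem smallPos_le_iff {n p q : ℕ} (hp : 0 < p) (hpq : p + 1 < q) (hq : q + 1 < n)
    (a b : Fin 6) :
    ((smallPos n p q a).1 ≤ (smallPos n p q b).1 ∧ (smallPos n p q a).2 ≤ (smallPos n p q b).2) ↔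
      ((a : ℕ) ≤ b ∧ ¬((a : ℕ) = 2 ∧ (b : ℕ) = 3)) := by
  fin_cases a <;> fin_cases b <;> simp [smallPos] <;> omega

theorem compl_subset_Des_twoSmall_iff {n i j : ℕ} {p q : Fin n} (hij : i < j) (hj : j ≤ n)
    (hp : 0 < (p : ℕ)) (hpq : (p : ℕ) + 1 < q) (hq : (q : ℕ) + 1 < n) :
    ({p, q} : Set (Fin n))ᶜ ⊆ Des (twoSmall n i j hij hj) ↔
      ∃ a, smallPos n p q a = (i, j) := by
  have hdes : ∀ k : Fin n, k ∈ Des (twoSmall n i j hij hj) ↔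
      (k : ℕ) ≠ j ∧ ((k : ℕ) = i → j = i + 1) := by
    intro k
    change twoSmall n i j hij hj k.succ < twoSmall n i j hij hj k.castSucc ↔ _
    simp only [Fin.lt_def, twoSmall_apply, Fin.val_succ, Fin.val_castSucc]
    split_ifs <;> omega
  constructor
  · intro h
    have hj' : j = p ∨ j = q ∨ j = n := by
      by_contra! hc
      refine ((hdes ⟨j, by omega⟩).1 (h ?_)).1 rfl
      simp [Fin.ext_iff]; omega
    have hi' : i = p ∨ i = q ∨ j = i + 1 := by
      by_contra! hc
      refine hc.2.2 (((hdes ⟨i, by omega⟩).1 (h ?_)).2 rfl)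
      simp [Fin.ext_iff]; omega
    have hcases : (i = p - 1 ∧ j = p) ∨ (i = p ∧ j = q) ∨ (i = q - 1 ∧ j = q) ∨
        (i = p ∧ j = n) ∨ (i = q ∧ j = n) ∨ (i = n - 1 ∧ j = n) := by omega
    rcases hcases with h | h | h | h | h | h
    · exact ⟨0, by simp [smallPos, h]⟩
    · exact ⟨1, by simp [smallPos, h]⟩
    · exact ⟨2, by simp [smallPos, h]⟩
    · exact ⟨3, by simp [smallPos, h]⟩
    · exact ⟨4, by simp [smallPos, h]⟩
    · exact ⟨5, by simp [smallPos, h]⟩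
  · rintro ⟨a, ha⟩ k hk
    rw [hdes]
    simp only [Set.mem_compl_iff, Set.mem_insert_iff, Set.mem_singleton_iff, Fin.ext_iff] at hk
    fin_cases a <;> simp [smallPos] at ha <;> omega

/-- The stretched diamond order on the restriction of the Bruhat order to `X`. -/
def IsStretchedDiamond {m : ℕ} (X : Set (Equiv.Perm (Fin m))) : Prop :=
  ∃ e : X ≃ Fin 6, ∀ a b : X, bruhatLE (a : Equiv.Perm (Fin m)) (b : Equiv.Perm (Fin m)) ↔
    ((e a : ℕ) ≤ (e b : ℕ) ∧ ¬((e a : ℕ) = 2 ∧ (e b : ℕ) = 3))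

theorem isStretchedDiamond_Xplus {n : ℕ} (hn : 5 ≤ n) {p q : Fin n} (hp : 0 < (p : ℕ))
    (hpq : (p : ℕ) + 1 < q) (hq : (q : ℕ) + 1 < n) :
    IsStretchedDiamond (Xplus ({⟨1, by omega⟩} : Set (Fin n))ᶜ ({p, q} : Set (Fin n))ᶜ) := by
  have hs := smallPos_spec hp hpq hq
  have hle := smallPos_le_iff hp hpq hq
  let f : Fin 6 → Xplus ({⟨1, by omega⟩} : Set (Fin n))ᶜ ({p, q} : Set (Fin n))ᶜ := fun a =>
    ⟨twoSmall n (smallPos n p q a).1 (smallPos n p q a).2 (hs a).1 (hs a).2,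
      fun k hk => subset_Des_inv_twoSmall _ _ _ _ _ fun h => hk (Fin.ext h),
      (compl_subset_Des_twoSmall_iff _ _ hp hpq hq).2 ⟨a, rfl⟩⟩
  have hf : ∀ a b, bruhatLE (f a : Equiv.Perm (Fin (n + 1))) (f b) ↔
      ((a : ℕ) ≤ b ∧ ¬((a : ℕ) = 2 ∧ (b : ℕ) = 3)) := fun a b =>
    (bruhatLE_twoSmall_iff _ _ _ _).trans (hle a b)
  have hbij : Function.Bijective f := by
    constructor
    · intro a b hab
      have h1 := (hf a b).1 (by rw [hab]; exact .refl)
      have h2 := (hf b a).1 (by rw [hab]; exact .refl)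
      exact Fin.ext (by omega)
    · rintro ⟨w, hI, hJ⟩
      obtain ⟨i, j, hij, hj, rfl⟩ := exists_eq_twoSmall (by omega) w
        fun k hk => hI fun h => hk (congrArg Fin.val h)
      obtain ⟨a, ha⟩ := (compl_subset_Des_twoSmall_iff _ _ hp hpq hq).1 hJ
      refine ⟨a, Subtype.ext ?_⟩
      simp only [f, ha]
  refine ⟨(Equiv.ofBijective f hbij).symm, fun a b => ?_⟩
  obtain ⟨a, rfl⟩ := hbij.2 a
  obtain ⟨b, rfl⟩ := hbij.2 b
  rw [Equiv.ofBijective_symm_apply_apply, Equiv.ofBijective_symm_apply_apply]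
  exact hf a b

theorem IsStretchedDiamond.isLatticeOn {m : ℕ} {X : Set (Equiv.Perm (Fin m))}
    (h : IsStretchedDiamond X) : IsLatticeOn X := by
  obtain ⟨e, he⟩ := h
  have hsup : ∀ a b : Fin 6, ∃ c : Fin 6,
      ((a : ℕ) ≤ c ∧ ¬((a : ℕ) = 2 ∧ (c : ℕ) = 3)) ∧
      ((b : ℕ) ≤ c ∧ ¬((b : ℕ) = 2 ∧ (c : ℕ) = 3)) ∧
      ∀ t : Fin 6, ((a : ℕ) ≤ t ∧ ¬((a : ℕ) = 2 ∧ (t : ℕ) = 3)) →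
        ((b : ℕ) ≤ t ∧ ¬((b : ℕ) = 2 ∧ (t : ℕ) = 3)) →
        ((c : ℕ) ≤ t ∧ ¬((c : ℕ) = 2 ∧ (t : ℕ) = 3)) := by decide
  have hinf : ∀ a b : Fin 6, ∃ c : Fin 6,
      ((c : ℕ) ≤ a ∧ ¬((c : ℕ) = 2 ∧ (a : ℕ) = 3)) ∧
      ((c : ℕ) ≤ b ∧ ¬((c : ℕ) = 2 ∧ (b : ℕ) = 3)) ∧
      ∀ t : Fin 6, ((t : ℕ) ≤ a ∧ ¬((t : ℕ) = 2 ∧ (a : ℕ) = 3)) →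
        ((t : ℕ) ≤ b ∧ ¬((t : ℕ) = 2 ∧ (b : ℕ) = 3)) →
        ((t : ℕ) ≤ c ∧ ¬((t : ℕ) = 2 ∧ (c : ℕ) = 3)) := by decide
  constructor
  · intro x hx y hy
    obtain ⟨c, h1, h2, h3⟩ := hsup (e ⟨x, hx⟩) (e ⟨y, hy⟩)
    obtain ⟨⟨z, hz⟩, rfl⟩ := e.surjective c
    exact ⟨z, hz, (he ⟨x, hx⟩ ⟨z, hz⟩).2 h1, (he ⟨y, hy⟩ ⟨z, hz⟩).2 h2, fun t ht hxt hyt =>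
      (he ⟨z, hz⟩ ⟨t, ht⟩).2
        (h3 _ ((he ⟨x, hx⟩ ⟨t, ht⟩).1 hxt) ((he ⟨y, hy⟩ ⟨t, ht⟩).1 hyt))⟩
  · intro x hx y hy
    obtain ⟨c, h1, h2, h3⟩ := hinf (e ⟨x, hx⟩) (e ⟨y, hy⟩)
    obtain ⟨⟨z, hz⟩, rfl⟩ := e.surjective c
    exact ⟨z, hz, (he ⟨z, hz⟩ ⟨x, hx⟩).2 h1, (he ⟨z, hz⟩ ⟨y, hy⟩).2 h2, fun t ht hxt hyt =>
      (he ⟨t, ht⟩ ⟨z, hz⟩).2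
        (h3 _ ((he ⟨t, ht⟩ ⟨x, hx⟩).1 hxt) ((he ⟨t, ht⟩ ⟨y, hy⟩).1 hyt))⟩

/-- Conjugation by the longest element. -/
def revConj {m : ℕ} : Equiv.Perm (Fin m) ≃* Equiv.Perm (Fin m) := MulAut.conj Fin.revPerm

theorem revConj_apply {m : ℕ} (w : Equiv.Perm (Fin m)) (x : Fin m) :
    revConj w x = (w x.rev).rev := rfl

theorem revConj_revConj {m : ℕ} (w : Equiv.Perm (Fin m)) : revConj (revConj w) = w := by
  ext x; simp [revConj_apply]

theorem sLen_revConj {m : ℕ} (w : Equiv.Perm (Fin m)) : sLen (revConj w) = sLen w := by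
  refine Finset.card_bij' (fun r _ => (r.2.rev, r.1.rev)) (fun r _ => (r.2.rev, r.1.rev))
    ?_ ?_ ?_ ?_ <;> simp [revConj_apply]

theorem bruhatLE_revConj {m : ℕ} {u v : Equiv.Perm (Fin m)} (h : bruhatLE u v) :
    bruhatLE (revConj u) (revConj v) := by
  refine Relation.ReflTransGen.lift revConj ?_ _ _ h
  rintro x _ ⟨⟨a, b, hab, rfl⟩, hl⟩
  refine ⟨⟨a.rev, b.rev, by simpa using hab, ?_⟩, by rwa [sLen_revConj, sLen_revConj]⟩
  rw [map_mul]
  congr 1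
  exact (Equiv.swap_apply_apply Fin.revPerm a b).symm

theorem bruhatLE_revConj_iff {m : ℕ} {u v : Equiv.Perm (Fin m)} :
    bruhatLE (revConj u) (revConj v) ↔ bruhatLE u v :=
  ⟨fun h => by simpa only [revConj_revConj] using bruhatLE_revConj h, bruhatLE_revConj⟩

theorem mem_Des_revConj {n : ℕ} {w : Equiv.Perm (Fin (n + 1))} {k : Fin n} :
    k ∈ Des (revConj w) ↔ k.rev ∈ Des w := by
  simp [Des, revConj_apply, Fin.rev_succ, Fin.rev_castSucc]

theorem revConj_mem_Xplus {n : ℕ} {I J : Set (Fin n)} {w : Equiv.Perm (Fin (n + 1))} :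
    revConj w ∈ Xplus (Fin.rev ⁻¹' I) (Fin.rev ⁻¹' J) ↔ w ∈ Xplus I J := by
  have key : ∀ (K : Set (Fin n)) (u : Equiv.Perm (Fin (n + 1))),
      Fin.rev ⁻¹' K ⊆ Des (revConj u) ↔ K ⊆ Des u := fun K u =>
    ⟨fun h k hk => by
      simpa using mem_Des_revConj.1 (h (show k.rev ∈ Fin.rev ⁻¹' K by simpa using hk)),
      fun h k hk => mem_Des_revConj.2 (h hk)⟩
  change _ ⊆ Des (revConj w)⁻¹ ∧ _ ↔ _
  rw [← map_inv, key, key]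
  rfl

theorem isStretchedDiamond_of_rev {n : ℕ} {I J : Set (Fin n)}
    (h : IsStretchedDiamond (Xplus (Fin.rev ⁻¹' I) (Fin.rev ⁻¹' J))) :
    IsStretchedDiamond (Xplus I J) := by
  obtain ⟨e, he⟩ := h
  refine ⟨(revConj.toEquiv.subtypeEquiv fun w => revConj_mem_Xplus.symm).trans e, fun a b => ?_⟩
  rw [← bruhatLE_revConj_iff]
  exact he ⟨revConj a, revConj_mem_Xplus.2 a.2⟩ ⟨revConj b, revConj_mem_Xplus.2 b.2⟩

/-- Let `n ≥ 5`, `I = R − {s_2}` or `R − {s_{n−1}}`, and `J = R − {s_p, s_q}` with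
`1 < p`, `p+1 < q`, `q < n` (1-based; indices below are 0-based).  Then `X⁺_{I,J}`
has exactly 6 elements and is order-isomorphic to the "stretched diamond" on
`{0,...,5}` with covers `0⋖1, 1⋖2, 1⋖3, 2⋖4, 3⋖4, 4⋖5` (its order relation is
`a ≤ b` in `ℕ` except that `2,3` are incomparable); in particular it is a lattice. -/
theorem stmt_5 (n : ℕ) (hn : 5 ≤ n) (I J : Set (Fin n))
    (hI : I = ({⟨1, by omega⟩} : Set (Fin n))ᶜ ∨ I = ({⟨n - 2, by omega⟩} : Set (Fin n))ᶜ)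
    (hJ : ∃ p q : Fin n, 0 < (p : ℕ) ∧ (p : ℕ) + 1 < (q : ℕ) ∧ (q : ℕ) + 1 < n ∧
      J = ({p, q} : Set (Fin n))ᶜ) :
    (∃ e : (Xplus I J) ≃ Fin 6,
      ∀ a b : (Xplus I J), bruhatLE (a : Equiv.Perm (Fin (n + 1))) (b : Equiv.Perm (Fin (n + 1))) ↔
        ((e a : ℕ) ≤ (e b : ℕ) ∧ ¬((e a : ℕ) = 2 ∧ (e b : ℕ) = 3))) ∧
    IsLatticeOn (Xplus I J) := by
  have h : IsStretchedDiamond (Xplus I J) := by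
    obtain ⟨p, q, hp, hpq, hq, rfl⟩ := hJ
    rcases hI with rfl | rfl
    · exact isStretchedDiamond_Xplus hn hp hpq hq
    · refine isStretchedDiamond_of_rev ?_
      have h := isStretchedDiamond_Xplus hn (p := q.rev) (q := p.rev)
        (by rw [Fin.val_rev]; omega) (by rw [Fin.val_rev, Fin.val_rev]; omega)
        (by rw [Fin.val_rev]; omega)
      convert h using 2
      · ext k
        simp [Fin.ext_iff]
        omega
      · ext k
        simp [Fin.ext_iff]
        omega
  exact ⟨h, h.isLatticeOn⟩
end

section
/- Let n ≥ 5 and W = S_{n+1}. Let I = R − {s_2} and J = R − {s_2, s_q} with 3 < q < n. Define τ₀ ∈ W in one-line notation by τ₀(1) = 2, τ₀(2) = 1, and τ₀(k) = n + 4 − k for 3 ≤ k ≤ n+1 (so τ₀ = (2, 1, n+1, n, ..., 3)). Then τ₀ ∈ X⁺_{I,J}, τ₀ is the unique minimal element of X⁺_{I,J} in the Bruhat order (τ₀ ≤ w for all w ∈ X⁺_{I,J}), and ℓ(τ₀) = 1 + (n−1)(n−2)/2. -/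
open Equiv in
/-- The simple transposition of `k` and `k + 1` preserves every strict inequality but one. -/
theorem swap_lt_swap_of_adjacent {m : ℕ} {k l i j : Fin m} (hkl : (l : ℕ) = k + 1) (hij : i < j)
    (hne : ¬(i = k ∧ j = l)) : swap k l i < swap k l j := by
  simp only [Fin.lt_def, Fin.ext_iff] at hij hne
  simp only [swap_apply_def, Fin.lt_def, Fin.ext_iff]
  split_ifs <;> omega

open Equiv in
/-- Multiplying on the right by a simple transposition at a descent decreases the length. -/
theorem sLen_mul_swap_lt_s6 {m : ℕ} (w : Perm (Fin m)) {k l : Fin m} (hkl : (l : ℕ) = k + 1)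
    (hw : w l < w k) : sLen (w * swap k l) < sLen w := by
  have hlt : k < l := by rw [Fin.lt_def]; omega
  unfold sLen
  rw [← Finset.card_map ((swap k l).prodCongr (swap k l)).toEmbedding]
  refine Finset.card_lt_card (Finset.ssubset_iff_subset_ne.2 ⟨?_, ?_⟩)
  · intro p hp
    obtain ⟨⟨i, j⟩, h, rfl⟩ := Finset.mem_map.1 hp
    obtain ⟨hij, hinv⟩ := (Finset.mem_filter.1 h).2
    refine Finset.mem_filter.2 ⟨Finset.mem_univ _, swap_lt_swap_of_adjacent hkl hij ?_, hinv⟩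
    rintro ⟨rfl, rfl⟩
    simp only [Perm.mul_apply, swap_apply_left, swap_apply_right] at hinv
    exact lt_asymm hinv hw
  · intro h
    have hmem : (k, l) ∈ Finset.univ.filter fun p : Fin m × Fin m => p.1 < p.2 ∧ w p.2 < w p.1 :=
      Finset.mem_filter.2 ⟨Finset.mem_univ _, hlt, hw⟩
    rw [← h] at hmem
    obtain ⟨⟨i, j⟩, h', he⟩ := Finset.mem_map.1 hmem
    obtain ⟨hij, -⟩ := (Finset.mem_filter.1 h').2
    have hi : swap k l i = k := congrArg Prod.fst he
    have hj : swap k l j = l := congrArg Prod.snd he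
    rw [swap_apply_eq_iff, swap_apply_left] at hi
    rw [swap_apply_eq_iff, swap_apply_right] at hj
    subst hi hj
    exact lt_asymm hij hlt

/-- A permutation is Bruhat-above the result of exchanging adjacent positions at a descent. -/
theorem bruhatLE_mul_swap_s6 {m : ℕ} (w : Equiv.Perm (Fin m)) {k l : Fin m} (hkl : (l : ℕ) = k + 1)
    (hw : w l < w k) : bruhatLE (w * Equiv.swap k l) w := by
  refine Relation.ReflTransGen.single ⟨⟨w k, w l, hw.ne', ?_⟩, sLen_mul_swap_lt_s6 w hkl hw⟩
  rw [Equiv.mul_swap_eq_swap_mul, Equiv.swap_mul_self_mul]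

/-- If `w⁻¹` has a descent everywhere but possibly at index `1`, and no value at least `2` is
immediately followed by a smaller value below `2`, then `w⁻¹ = (1, 0, n, n - 1, ..., 2)`. -/
theorem inv_apply_of_no_crossing {n : ℕ} (hn : 2 ≤ n) (w : Equiv.Perm (Fin (n + 1)))
    (hw : ∀ i j : Fin (n + 1), (j : ℕ) = i + 1 → (i : ℕ) ≠ 1 → w⁻¹ j < w⁻¹ i)
    (hc : ∀ k l : Fin (n + 1), (l : ℕ) = k + 1 → (w l : ℕ) < 2 → (w k : ℕ) < 2) :
    (w⁻¹ ⟨0, by omega⟩ : ℕ) = 1 ∧ (w⁻¹ ⟨1, by omega⟩ : ℕ) = 0 ∧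
      ∀ i : Fin (n + 1), 2 ≤ (i : ℕ) → (w⁻¹ i : ℕ) = n + 2 - i := by
  have down : ∀ d : ℕ, ∀ k l : Fin (n + 1), (l : ℕ) = k + d → (w l : ℕ) < 2 → (w k : ℕ) < 2 := by
    intro d
    induction d with
    | zero =>
      intro k l h hl
      rwa [show k = l from Fin.ext (by omega)]
    | succ d ih =>
      intro k l h hl
      exact ih k ⟨k + d, by omega⟩ rfl (hc _ l (by simp only; omega) hl)
  have h10 := hw ⟨0, by omega⟩ ⟨1, by omega⟩ rfl (by simp)
  have hinj : ∀ a b : Fin (n + 1), (a : ℕ) ≠ b → (w a : ℕ) ≠ w b := fun a b hab h =>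
    hab (congrArg Fin.val (w.injective (Fin.ext h)))
  have hP : (w⁻¹ ⟨0, by omega⟩ : ℕ) < 2 := by
    by_contra! hP
    have hlow : ∀ k : Fin (n + 1), (k : ℕ) ≤ 2 → (w k : ℕ) < 2 := fun k hk =>
      down (w⁻¹ ⟨0, by omega⟩ - k) k (w⁻¹ ⟨0, by omega⟩) (by omega) (by simp)
    have h0 := hlow ⟨0, by omega⟩ (by simp)
    have h1 := hlow ⟨1, by omega⟩ (by simp)
    have h2 := hlow ⟨2, by omega⟩ (by simp)
    have := hinj ⟨0, by omega⟩ ⟨1, by omega⟩ (by simp)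
    have := hinj ⟨0, by omega⟩ ⟨2, by omega⟩ (by simp)
    have := hinj ⟨1, by omega⟩ ⟨2, by omega⟩ (by simp)
    omega
  rw [Fin.lt_def] at h10
  have e0 : (w⁻¹ ⟨0, by omega⟩ : ℕ) = 1 := by omega
  have e1 : (w⁻¹ ⟨1, by omega⟩ : ℕ) = 0 := by omega
  refine ⟨e0, e1, ?_⟩
  have hinj' : ∀ a b : Fin (n + 1), (a : ℕ) ≠ b → (w⁻¹ a : ℕ) ≠ w⁻¹ b := fun a b hab h =>
    hab (congrArg Fin.val (w⁻¹.injective (Fin.ext h)))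
  have upper : ∀ d : ℕ, ∀ h : d + 2 < n + 1, (w⁻¹ ⟨d + 2, h⟩ : ℕ) + d ≤ n := by
    intro d
    induction d with
    | zero => intro h; omega
    | succ d ih =>
      intro h
      have h1 := ih (by omega)
      have h2 := hw ⟨d + 2, by omega⟩ ⟨d + 1 + 2, h⟩ (by grind) (by simp)
      rw [Fin.lt_def] at h2
      omega
  have lower : ∀ d : ℕ, ∀ i : Fin (n + 1), 2 ≤ (i : ℕ) → (i : ℕ) + d = n →
      2 + d ≤ (w⁻¹ i : ℕ) := by
    intro d
    induction d with
    | zero =>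
      intro i hi hd
      have h0 := hinj' i ⟨0, by omega⟩ (by simp only; omega)
      have h1 := hinj' i ⟨1, by omega⟩ (by simp only; omega)
      omega
    | succ d ih =>
      intro i hi hd
      have h1 := ih ⟨i + 1, by omega⟩ (by simp only; omega) (by simp only; omega)
      have h2 := hw i ⟨i + 1, by omega⟩ rfl (by omega)
      rw [Fin.lt_def] at h2
      omega
  intro i hi
  have h1 := upper (i - 2) (by omega)
  have h2 := lower (n - i) i hi (by omega)
  have h3 : (⟨(i : ℕ) - 2 + 2, by omega⟩ : Fin (n + 1)) = i := Fin.ext (by simp only; omega)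
  rw [h3] at h1
  omega

/-- The permutation `(1, 0, n, n - 1, ..., 2)` lies Bruhat-below every `w` whose inverse has
a descent everywhere but possibly at index `1`. -/
theorem bruhatLE_of_descents_inv {n : ℕ} (hn : 2 ≤ n) (τ : Equiv.Perm (Fin (n + 1)))
    (hτ : (τ ⟨0, by omega⟩ : ℕ) = 1 ∧ (τ ⟨1, by omega⟩ : ℕ) = 0 ∧
      ∀ k : Fin (n + 1), 2 ≤ (k : ℕ) → (τ k : ℕ) = n + 2 - (k : ℕ))
    (w : Equiv.Perm (Fin (n + 1)))
    (hw : ∀ i j : Fin (n + 1), (j : ℕ) = i + 1 → (i : ℕ) ≠ 1 → w⁻¹ j < w⁻¹ i) :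
    bruhatLE τ w := by
  induction hN : sLen w using Nat.strong_induction_on generalizing w with
  | _ N ih =>
  subst hN
  by_cases hc : ∀ k l : Fin (n + 1), (l : ℕ) = k + 1 → (w l : ℕ) < 2 → (w k : ℕ) < 2
  · obtain ⟨h0, h1, h2⟩ := inv_apply_of_no_crossing hn w hw hc
    obtain ⟨t0, t1, t2⟩ := hτ
    have : τ * w⁻¹ = 1 := by
      ext i
      rw [Equiv.Perm.mul_apply, Equiv.Perm.one_apply]
      obtain hi | hi | hi : (i : ℕ) = 0 ∨ (i : ℕ) = 1 ∨ 2 ≤ (i : ℕ) := by omega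
      · rw [show i = ⟨0, by omega⟩ from Fin.ext hi,
          show w⁻¹ ⟨0, by omega⟩ = ⟨1, by omega⟩ from Fin.ext h0, t1]
      · rw [show i = ⟨1, by omega⟩ from Fin.ext hi,
          show w⁻¹ ⟨1, by omega⟩ = ⟨0, by omega⟩ from Fin.ext h1, t0]
      · have := h2 i hi
        rw [t2 _ (by omega)]
        omega
    rw [mul_inv_eq_one.1 this]
    exact Relation.ReflTransGen.refl
  · push Not at hc
    obtain ⟨k, l, hkl, hl, hk⟩ := hc
    have hlt : w l < w k := by rw [Fin.lt_def]; omega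
    refine Relation.ReflTransGen.trans
      (ih _ (sLen_mul_swap_lt_s6 w hkl hlt) (w * Equiv.swap k l) ?_ rfl) (bruhatLE_mul_swap_s6 w hkl hlt)
    intro i j hij hi
    rw [mul_inv_rev, Equiv.swap_inv, Equiv.Perm.mul_apply, Equiv.Perm.mul_apply]
    refine swap_lt_swap_of_adjacent hkl (hw i j hij hi) ?_
    rintro ⟨hj, hi'⟩
    rw [Equiv.Perm.inv_eq_iff_eq] at hj hi'
    subst hj hi'
    omega

/-- The length of `(1, 0, n, n - 1, ..., 2)`. -/
theorem sLen_of_apply {n : ℕ} (hn : 1 ≤ n) (τ : Equiv.Perm (Fin (n + 1)))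
    (hτ : (τ ⟨0, by omega⟩ : ℕ) = 1 ∧ (τ ⟨1, by omega⟩ : ℕ) = 0 ∧
      ∀ k : Fin (n + 1), 2 ≤ (k : ℕ) → (τ k : ℕ) = n + 2 - (k : ℕ)) :
    sLen τ = 1 + (n - 1) * (n - 2) / 2 := by
  obtain ⟨m, rfl⟩ : ∃ m, n = m + 1 := ⟨n - 1, by omega⟩
  obtain ⟨t0, t1, t2⟩ := hτ
  have t0' : (τ 0 : ℕ) = 1 := t0
  have t1' : (τ 1 : ℕ) = 0 := t1
  have hfiber : sLen τ =
      ∑ i, (Finset.univ.filter fun j : Fin (m + 2) => i < j ∧ τ j < τ i).card := by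
    unfold sLen
    simp only [Finset.card_filter]
    rw [Fintype.sum_prod_type]
  have hzero : (Finset.univ.filter fun j : Fin (m + 2) => 0 < j ∧ τ j < τ 0) = {1} := by
    ext j
    simp only [Finset.mem_filter, Finset.mem_univ, true_and, Finset.mem_singleton]
    constructor
    · rintro ⟨-, h⟩
      refine τ.injective (Fin.ext ?_)
      rw [Fin.lt_def] at h
      omega
    · rintro rfl
      refine ⟨by simp, ?_⟩
      rw [Fin.lt_def]
      omega
  have hone : (Finset.univ.filter fun j : Fin (m + 2) => 1 < j ∧ τ j < τ 1) = ∅ := by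
    refine Finset.filter_eq_empty_iff.2 fun j _ h => ?_
    have := h.2
    rw [Fin.lt_def] at this
    omega
  have hrest : ∀ i : Fin m, (Finset.univ.filter fun j : Fin (m + 2) =>
      i.succ.succ < j ∧ τ j < τ i.succ.succ).card = m - 1 - i := by
    intro i
    have : (Finset.univ.filter fun j : Fin (m + 2) =>
        i.succ.succ < j ∧ τ j < τ i.succ.succ) = Finset.Ioi i.succ.succ := by
      ext j
      simp only [Finset.mem_filter, Finset.mem_univ, true_and, Finset.mem_Ioi, and_iff_left_iff_imp]
      intro h
      rw [Fin.lt_def, Fin.val_succ, Fin.val_succ] at h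
      rw [Fin.lt_def, t2 j (by omega), t2 i.succ.succ (by simp), Fin.val_succ, Fin.val_succ]
      omega
    rw [this, Fin.card_Ioi, Fin.val_succ, Fin.val_succ]
    omega
  rw [hfiber, Fin.sum_univ_succ, Fin.sum_univ_succ, hzero, Fin.succ_zero_eq_one, hone]
  simp only [hrest]
  rw [Fin.sum_univ_eq_sum_range (fun i => m - 1 - i), Finset.sum_range_reflect (fun i => i),
    Finset.sum_range_id]
  simp

/-- Let `n ≥ 5`, `I = R − {s_2}`, `J = R − {s_2, s_q}` with `3 < q < n` (1-based),
and let `τ₀ = (2, 1, n+1, n, ..., 3)` in (1-based) one-line notation, i.e. in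
0-based terms `τ₀(0) = 1`, `τ₀(1) = 0`, and `τ₀(k) = n + 2 − k` for `2 ≤ k ≤ n`.
Then `τ₀ ∈ X⁺_{I,J}`, `τ₀` is the unique minimal element of `X⁺_{I,J}` in the
Bruhat order, and `ℓ(τ₀) = 1 + (n−1)(n−2)/2`. -/
theorem stmt_6 (n : ℕ) (hn : 5 ≤ n) (q : ℕ) (hq1 : 3 < q) (hq2 : q < n)
    (I J : Set (Fin n))
    (hI : I = ({⟨1, by omega⟩} : Set (Fin n))ᶜ)
    (hJ : J = ({⟨1, by omega⟩, ⟨q - 1, by omega⟩} : Set (Fin n))ᶜ)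
    (τ₀ : Equiv.Perm (Fin (n + 1)))
    (hτ : (τ₀ ⟨0, by omega⟩ : ℕ) = 1 ∧ (τ₀ ⟨1, by omega⟩ : ℕ) = 0 ∧
      ∀ k : Fin (n + 1), 2 ≤ (k : ℕ) → (τ₀ k : ℕ) = n + 2 - (k : ℕ)) :
    τ₀ ∈ Xplus I J ∧ (∀ w ∈ Xplus I J, bruhatLE τ₀ w) ∧
      sLen τ₀ = 1 + (n - 1) * (n - 2) / 2 := by
  refine ⟨⟨?_, ?_⟩, ?_, sLen_of_apply (by omega) τ₀ hτ⟩
  · obtain ⟨t0, t1, t2⟩ := hτ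
    have hval : ∀ i : Fin (n + 1), (i : ℕ) ≠ 0 → (i : ℕ) ≠ 1 →
        (τ₀⁻¹ i : ℕ) = n + 2 - i := by
      intro i h0 h1
      have hi : τ₀ ⟨n + 2 - i, by omega⟩ = i := by
        refine Fin.ext ?_
        rw [t2 _ (by simp only; omega)]
        simp only
        omega
      rw [← Equiv.Perm.eq_inv_iff_eq] at hi
      rw [← hi]
    have hv0 : τ₀⁻¹ ⟨0, by omega⟩ = ⟨1, by omega⟩ := Equiv.Perm.inv_eq_iff_eq.2 (Fin.ext t1.symm)
    have hv1 : τ₀⁻¹ ⟨1, by omega⟩ = ⟨0, by omega⟩ := Equiv.Perm.inv_eq_iff_eq.2 (Fin.ext t0.symm)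
    intro i hi
    have hi1 : (i : ℕ) ≠ 1 := by
      rintro h
      rw [hI] at hi
      exact hi (Fin.ext h)
    change τ₀⁻¹ i.succ < τ₀⁻¹ i.castSucc
    by_cases hi0 : (i : ℕ) = 0
    · rw [show i.succ = ⟨1, by omega⟩ from Fin.ext (by simp [hi0]),
        show i.castSucc = ⟨0, by omega⟩ from Fin.ext (by simp [hi0]), hv0, hv1, Fin.lt_def]
      exact Nat.zero_lt_one
    · rw [Fin.lt_def, hval _ (by simp) (by simpa using hi0), hval _ (by simpa using hi0)
        (by simpa using hi1), Fin.val_succ, Fin.val_castSucc]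
      omega
  · obtain ⟨t0, t1, t2⟩ := hτ
    intro i hi
    have hi1 : (i : ℕ) ≠ 1 := by
      rintro h
      rw [hJ] at hi
      exact hi (Or.inl (Fin.ext h))
    change τ₀ i.succ < τ₀ i.castSucc
    by_cases hi0 : (i : ℕ) = 0
    · rw [show i.succ = ⟨1, by omega⟩ from Fin.ext (by simp [hi0]),
        show i.castSucc = ⟨0, by omega⟩ from Fin.ext (by simp [hi0]), Fin.lt_def, t0, t1]
      simp
    · rw [Fin.lt_def, t2 i.succ (by rw [Fin.val_succ]; omega),
        t2 i.castSucc (by rw [Fin.val_castSucc]; omega), Fin.val_succ, Fin.val_castSucc]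
      omega
  · rintro w ⟨hw, -⟩
    refine bruhatLE_of_descents_inv (by omega) τ₀ hτ w fun i j hij hi => ?_
    have hmem : (⟨i, by omega⟩ : Fin n) ∈ I := by
      rw [hI]
      exact fun h => hi (congrArg Fin.val h)
    have h : w⁻¹ (Fin.succ ⟨i, by omega⟩) < w⁻¹ (Fin.castSucc ⟨i, by omega⟩) := hw hmem
    rwa [show Fin.succ ⟨i, by omega⟩ = j from Fin.ext (by simp [hij]),
      show Fin.castSucc ⟨i, by omega⟩ = i from rfl] at h
end

section
/- Let n ≥ 1, W = S_{n+1}, and 1 ≤ k ≤ n+1. Suppose w ∈ W ends, in one-line notation, with the decreasing string k, k−1, ..., 2, 1; that is, w(n+2−m) = m for all 1 ≤ m ≤ k. Then every w' ∈ W with w ≤ w' in the Bruhat order satisfies w'(n+2−m) = m for all 1 ≤ m ≤ k, i.e., w' has the same last k entries k, k−1, ..., 1 in the same positions. -/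
/-- Exchanging the entries of an inversion of `x` does not increase the length. -/
theorem sLen_mul_swap_le {m : ℕ} (x : Equiv.Perm (Fin m)) {i j : Fin m} (hij : i < j)
    (hx : x j < x i) : sLen (x * Equiv.swap i j) ≤ sLen x := by
  unfold sLen
  refine Finset.card_le_card_of_injOn
    (fun p => if Equiv.swap i j p.1 < Equiv.swap i j p.2 then
      (Equiv.swap i j p.1, Equiv.swap i j p.2) else p) ?_ ?_
  · rintro ⟨p, q⟩ hpq
    obtain ⟨hlt, hinv⟩ := (Finset.mem_filter.1 hpq).2
    refine Finset.mem_filter.2 ⟨Finset.mem_univ _, ?_⟩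
    simp only [Equiv.Perm.mul_apply] at hlt hinv ⊢
    split_ifs with h
    · exact ⟨h, hinv⟩
    · refine ⟨hlt, ?_⟩
      simp only [Equiv.swap_apply_def] at h hinv
      grind
  · rintro ⟨p, q⟩ hpq ⟨p', q'⟩ hpq' heq
    simp only [Finset.mem_coe, Finset.mem_filter, Finset.mem_univ, true_and] at hpq hpq'
    dsimp only at heq
    have hs := Equiv.swap_apply_self i j
    split_ifs at heq with h h' h'
    · simpa using heq
    · obtain ⟨rfl, rfl⟩ := Prod.mk.inj heq
      simp only [Equiv.swap_apply_self] at h'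
      exact absurd hpq.1 h'
    · obtain ⟨rfl, rfl⟩ := Prod.mk.inj heq
      simp only [Equiv.swap_apply_self] at h
      exact absurd hpq'.1 h
    · exact heq

/-- If left multiplication by the transposition of the values `a < b` increases the length,
then `a` stands to the left of `b`. -/
theorem inv_lt_inv_of_sLen_lt {m : ℕ} (x : Equiv.Perm (Fin m)) {a b : Fin m} (hab : a < b)
    (h : sLen x < sLen (Equiv.swap a b * x)) : x⁻¹ a < x⁻¹ b := by
  by_contra! hle
  have hlt : x⁻¹ b < x⁻¹ a := lt_of_le_of_ne hle fun e => hab.ne' (x⁻¹.injective e)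
  rw [Equiv.swap_mul_eq_mul_swap, Equiv.swap_comm] at h
  exact absurd h (sLen_mul_swap_le x hlt (by simpa using hab)).not_gt

/-- A length-increasing transposition of values fixes a decreasing final string
`k, ..., 2, 1`. -/
theorem final_string_swap_mul {n k : ℕ} (hk : k ≤ n + 1) (x : Equiv.Perm (Fin (n + 1)))
    {a b : Fin (n + 1)} (hab : a < b) (h : sLen x < sLen (Equiv.swap a b * x))
    (hx : ∀ m : ℕ, ∀ _hm1 : 1 ≤ m, ∀ _hm2 : m ≤ k, (x ⟨n + 1 - m, by omega⟩ : ℕ) = m - 1) :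
    ∀ m : ℕ, ∀ _hm1 : 1 ≤ m, ∀ _hm2 : m ≤ k,
      ((Equiv.swap a b * x) ⟨n + 1 - m, by omega⟩ : ℕ) = m - 1 := by
  have hpos := inv_lt_inv_of_sLen_lt x hab h
  have hka : k ≤ (a : ℕ) := by
    by_contra! hak
    have ha : x⁻¹ a = ⟨n + 1 - (a + 1), by omega⟩ := by
      rw [Equiv.Perm.inv_eq_iff_eq]
      exact Fin.ext (hx (a + 1) (by omega) (by omega)).symm
    rw [ha, Fin.lt_def] at hpos
    have hb := hx (n + 1 - (x⁻¹ b : ℕ)) (by omega) (by simp only at hpos; omega)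
    have hbx : (⟨n + 1 - (n + 1 - (x⁻¹ b : ℕ)), by omega⟩ : Fin (n + 1)) = x⁻¹ b :=
      Fin.ext (by simp only; omega)
    rw [hbx, show x (x⁻¹ b) = b from x.apply_symm_apply b] at hb
    rw [Fin.lt_def] at hab
    simp only at hpos
    omega
  intro m hm1 hm2
  have hm := hx m hm1 hm2
  rw [Fin.lt_def] at hab
  rw [Equiv.Perm.mul_apply, Equiv.swap_apply_of_ne_of_ne, hm]
  · intro e
    rw [e] at hm
    omega
  · intro e
    rw [e] at hm
    omega

/-- If `w ∈ S_{n+1}` ends with the decreasing string `k, k−1, ..., 1`, i.e.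
`w(n+2−m) = m` for `1 ≤ m ≤ k` (1-based; below `w ⟨n+1−m⟩ = m−1` in 0-based terms),
then every `w'` with `w ≤ w'` in the Bruhat order has the same last `k` entries. -/
theorem stmt_8 (n : ℕ) (hn : 1 ≤ n) (k : ℕ) (hk1 : 1 ≤ k) (hk2 : k ≤ n + 1)
    (w w' : Equiv.Perm (Fin (n + 1)))
    (hw : ∀ m : ℕ, ∀ _hm1 : 1 ≤ m, ∀ _hm2 : m ≤ k,
      (w ⟨n + 1 - m, by omega⟩ : ℕ) = m - 1)
    (hle : bruhatLE w w') :
    ∀ m : ℕ, ∀ _hm1 : 1 ≤ m, ∀ _hm2 : m ≤ k,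
      (w' ⟨n + 1 - m, by omega⟩ : ℕ) = m - 1 := by
  unfold bruhatLE at hle
  induction hle with
  | refl => exact hw
  | tail _ hstep ih =>
    obtain ⟨⟨a, b, hab, rfl⟩, hlen⟩ := hstep
    rcases lt_or_gt_of_ne hab with h | h
    · exact final_string_swap_mul hk2 _ h hlen ih
    · rw [Equiv.swap_comm] at hlen ⊢
      exact final_string_swap_mul hk2 _ h hlen ih
end

section
/- Let n ≥ 5 and W = S_{n+1}. Let I = R − {s_i} with 2 ≤ i ≤ n−1 and J = R − {s_1, s_j} with 2 < j < n−1, and assume j ≤ i. Define τ₀ ∈ W in one-line notation by: τ₀(k) = i+1−k for 1 ≤ k ≤ j; τ₀(k) = n+j+2−k for j+1 ≤ k ≤ j+n+1−i; and τ₀(k) = n+2−k for j+n+2−i ≤ k ≤ n+1 (so τ₀ = (i, i−1, ..., i−j+1, n+1, n, ..., i+1, i−j, i−j−1, ..., 1)). Then τ₀ ∈ X⁺_{I,J} and τ₀ is the unique minimal element of X⁺_{I,J} in the Bruhat order. -/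
/-- The inversions of `w`, recorded as pairs of values. -/
def valueInversions {m : ℕ} (w : Equiv.Perm (Fin m)) : Finset (Fin m × Fin m) :=
  Finset.univ.filter fun p => p.1 < p.2 ∧ w⁻¹ p.2 < w⁻¹ p.1

theorem mem_valueInversions {m : ℕ} {w : Equiv.Perm (Fin m)} {p : Fin m × Fin m} :
    p ∈ valueInversions w ↔ p.1 < p.2 ∧ w⁻¹ p.2 < w⁻¹ p.1 := by
  simp [valueInversions]

theorem card_valueInversions {m : ℕ} (w : Equiv.Perm (Fin m)) :
    (valueInversions w).card = sLen w := by
  refine Finset.card_bij' (fun p _ => (w⁻¹ p.2, w⁻¹ p.1)) (fun p _ => (w p.2, w p.1))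
    ?_ ?_ ?_ ?_ <;> intro p hp <;> simp_all [valueInversions]

theorem valueInversions_mul_swap_ssubset {n : ℕ} (v : Equiv.Perm (Fin (n + 1))) {k : Fin n}
    (hk : v k.succ < v k.castSucc) :
    valueInversions (v * Equiv.swap k.castSucc k.succ) ⊂ valueInversions v := by
  refine Finset.ssubset_iff_subset_ne.2 ⟨?_, ?_⟩
  · rintro ⟨a, b⟩ h
    rw [mem_valueInversions] at h ⊢
    obtain ⟨hab, h⟩ := h
    refine ⟨hab, ?_⟩
    obtain ⟨x, rfl⟩ := v.surjective a
    obtain ⟨y, rfl⟩ := v.surjective b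
    simp only [mul_inv_rev, Equiv.swap_inv, Equiv.Perm.mul_apply, Equiv.Perm.coe_inv,
      Equiv.symm_apply_apply] at h hab ⊢
    by_contra hxy
    rw [Equiv.swap_apply_def, Equiv.swap_apply_def] at h
    simp only [Fin.lt_def, Fin.ext_iff] at *
    split_ifs at h <;> simp only [Fin.val_castSucc, Fin.val_succ] at * <;> try omega
    have hx : x = k.castSucc := Fin.ext (by simp only [Fin.val_castSucc]; omega)
    have hy : y = k.succ := Fin.ext (by simp only [Fin.val_succ]; omega)
    subst hx hy
    omega
  · intro h
    have hmem : (v k.succ, v k.castSucc) ∈ valueInversions v := by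
      simpa [mem_valueInversions] using hk
    rw [← h, mem_valueInversions] at hmem
    have := hmem.2
    simp [Fin.lt_def] at this

/-- A bijection between finite chains that preserves the order of neighbours is the identity. -/
theorem Equiv.Perm.eq_one_of_castSucc_lt_succ {n : ℕ} (f : Equiv.Perm (Fin (n + 1)))
    (h : ∀ k : Fin n, f k.castSucc < f k.succ) : f = 1 := by
  have hf : StrictMono f := Fin.strictMono_iff_lt_succ.2 h
  ext x
  have := congrArg (fun e : Fin (n + 1) ≃o Fin (n + 1) => e x)
    (Subsingleton.elim (hf.orderIsoOfSurjective f f.surjective) (OrderIso.refl _))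
  simpa using congrArg Fin.val this

/-- Containment of inversion sets (the weak order) implies the Bruhat order. -/
theorem bruhatLE_of_valueInversions_subset {n : ℕ} {u v : Equiv.Perm (Fin (n + 1))}
    (h : valueInversions u ⊆ valueInversions v) : bruhatLE u v := by
  induction hN : sLen v using Nat.strong_induction_on generalizing v with
  | _ N ih =>
    subst hN
    by_cases hex : ∃ k : Fin n, v k.succ < v k.castSucc ∧
        (v k.succ, v k.castSucc) ∉ valueInversions u
    · obtain ⟨k, hk, hku⟩ := hex
      have hss := valueInversions_mul_swap_ssubset v hk
      have hlt : sLen (v * Equiv.swap k.castSucc k.succ) < sLen v := by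
        rw [← card_valueInversions, ← card_valueInversions]
        exact Finset.card_lt_card hss
      refine Relation.ReflTransGen.tail (ih _ hlt ?_ rfl)
        ⟨⟨v k.castSucc, v k.succ, hk.ne', ?_⟩, hlt⟩
      · rintro ⟨a, b⟩ hp
        have hv := mem_valueInversions.1 (h hp)
        rw [mem_valueInversions]
        refine ⟨hv.1, ?_⟩
        obtain ⟨x, rfl⟩ := v.surjective a
        obtain ⟨y, rfl⟩ := v.surjective b
        have hne : ¬ (x = k.succ ∧ y = k.castSucc) := by
          rintro ⟨rfl, rfl⟩
          exact hku hp
        obtain ⟨-, hv⟩ := hv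
        simp only [mul_inv_rev, Equiv.swap_inv, Equiv.Perm.mul_apply,
          Equiv.Perm.coe_inv, Equiv.symm_apply_apply] at hv ⊢
        rw [Equiv.swap_apply_def, Equiv.swap_apply_def]
        simp only [Fin.lt_def, Fin.ext_iff, Fin.val_castSucc, Fin.val_succ] at *
        split_ifs <;> try simp only [Fin.val_castSucc, Fin.val_succ]
        all_goals omega
      · rw [Equiv.mul_swap_eq_swap_mul, ← mul_assoc, Equiv.swap_mul_self, one_mul]
    · push Not at hex
      have hone : u⁻¹ * v = 1 := by
        refine Equiv.Perm.eq_one_of_castSucc_lt_succ _ fun k => ?_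
        rw [Equiv.Perm.mul_apply, Equiv.Perm.mul_apply]
        rcases lt_or_ge (v k.succ) (v k.castSucc) with hk | hk
        · exact (mem_valueInversions.1 (hex k hk)).2
        · by_contra hcon
          have hne : v k.castSucc ≠ v k.succ := fun e =>
            (Fin.castSucc_lt_succ (i := k)).ne (v.injective e)
          have hlt : u⁻¹ (v k.succ) < u⁻¹ (v k.castSucc) :=
            lt_of_le_of_ne (not_lt.1 hcon) fun e => hne (u⁻¹.injective e).symm
          have := (mem_valueInversions.1
            (h (mem_valueInversions (p := (v k.castSucc, v k.succ)).2
              ⟨lt_of_le_of_ne hk hne, hlt⟩))).2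
          simp [Fin.lt_def] at this
      rw [inv_mul_eq_one.1 hone]
      exact Relation.ReflTransGen.refl

/-- A function with descents throughout `[a, b]` is strictly decreasing on `[a, b]`. -/
theorem lt_of_forall_succ_lt_castSucc {n a b : ℕ} {f : Fin (n + 1) → Fin (n + 1)}
    (h : ∀ k : Fin n, a ≤ k → (k : ℕ) < b → f k.succ < f k.castSucc) {p q : Fin (n + 1)}
    (hp : a ≤ p) (hpq : p < q) (hq : (q : ℕ) ≤ b) : f q < f p := by
  induction q using Fin.induction with
  | zero => exact absurd hpq (Fin.not_lt_zero p)
  | succ k ih =>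
    rw [Fin.lt_def, Fin.val_succ] at hpq
    rw [Fin.val_succ] at hq
    have hk := h k (by omega) (by omega)
    rcases Nat.lt_succ_iff_lt_or_eq.1 hpq with hlt | heq
    · exact hk.trans (ih (by simpa [Fin.lt_def] using hlt) (by simp; omega))
    · rwa [show p = k.castSucc from Fin.ext (by simpa using heq)]

/-- Let `n ≥ 5`, `I = R − {s_i}` with `2 ≤ i ≤ n−1`, `J = R − {s_1, s_j}` with
`2 < j < n−1` and `j ≤ i` (all 1-based).  Let
`τ₀ = (i, i−1, ..., i−j+1, n+1, n, ..., i+1, i−j, ..., 1)` in one-line notation;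
in 0-based terms `τ₀(k) = i−1−k` for `k < j`, `τ₀(k) = n+j−k` for `j ≤ k ≤ j+n−i`,
and `τ₀(k) = n−k` for `j+n+1−i ≤ k ≤ n`.  Then `τ₀ ∈ X⁺_{I,J}` and `τ₀` is the
unique minimal element of `X⁺_{I,J}` in the Bruhat order. -/
theorem stmt_10 (n : ℕ) (hn : 5 ≤ n) (i j : ℕ)
    (hi1 : 2 ≤ i) (hi2 : i ≤ n - 1) (hj1 : 2 < j) (hj2 : j < n - 1) (hji : j ≤ i)
    (I J : Set (Fin n))
    (hI : I = ({⟨i - 1, by omega⟩} : Set (Fin n))ᶜ)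
    (hJ : J = ({⟨0, by omega⟩, ⟨j - 1, by omega⟩} : Set (Fin n))ᶜ)
    (τ₀ : Equiv.Perm (Fin (n + 1)))
    (hτ : ∀ k : Fin (n + 1),
      ((k : ℕ) < j → (τ₀ k : ℕ) = i - 1 - (k : ℕ)) ∧
      (j ≤ (k : ℕ) → (k : ℕ) ≤ j + n - i → (τ₀ k : ℕ) = n + j - (k : ℕ)) ∧
      (j + n + 1 - i ≤ (k : ℕ) → (τ₀ k : ℕ) = n - (k : ℕ))) :
    τ₀ ∈ Xplus I J ∧ ∀ w ∈ Xplus I J, bruhatLE τ₀ w := by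
  subst hI hJ
  refine ⟨⟨fun k hk => ?_, fun k hk => ?_⟩, fun w hw => ?_⟩
  · simp only [Set.mem_compl_iff, Set.mem_singleton_iff, Fin.ext_iff] at hk
    change τ₀⁻¹ k.succ < τ₀⁻¹ k.castSucc
    have hp := hτ (τ₀⁻¹ k.castSucc)
    have hq := hτ (τ₀⁻¹ k.succ)
    simp only [Equiv.Perm.coe_inv, Equiv.apply_symm_apply, Fin.val_castSucc, Fin.val_succ] at hp hq
    rw [Fin.lt_def, Equiv.Perm.coe_inv]
    omega
  · simp only [Set.mem_compl_iff, Set.mem_insert_iff, Set.mem_singleton_iff, Fin.ext_iff,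
      not_or] at hk
    change τ₀ k.succ < τ₀ k.castSucc
    have hp := hτ k.castSucc
    have hq := hτ k.succ
    simp only [Fin.val_castSucc, Fin.val_succ] at hp hq
    rw [Fin.lt_def]
    omega
  · obtain ⟨hwI, hwJ⟩ := hw
    have hdesI : ∀ k : Fin n, (k : ℕ) ≠ i - 1 → w⁻¹ k.succ < w⁻¹ k.castSucc :=
      fun k hk => hwI (by simpa [Fin.ext_iff] using hk)
    have hdesJ : ∀ k : Fin n, j ≤ k → (k : ℕ) < n → w k.succ < w k.castSucc := by
      refine fun k hk _ => hwJ ?_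
      simp only [Set.mem_compl_iff, Set.mem_insert_iff, Set.mem_singleton_iff, Fin.ext_iff]
      omega
    have hsmall : ∀ t : ℕ, ∀ a : Fin (n + 1), (a : ℕ) + t = i - 1 → t ≤ w⁻¹ a := by
      intro t
      induction t with
      | zero => intros; omega
      | succ t ih =>
        intro a ha
        have h1 := ih ⟨a + 1, by omega⟩ (by simp; omega)
        have h2 := hdesI ⟨a, by omega⟩ (by simp; omega)
        simp only [Fin.lt_def, Fin.succ_mk, Fin.castSucc_mk, Fin.eta] at h2
        omega
    apply bruhatLE_of_valueInversions_subset
    rintro ⟨a, b⟩ hab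
    rw [mem_valueInversions] at hab ⊢
    obtain ⟨hab, hinv⟩ := hab
    refine ⟨hab, ?_⟩
    dsimp only at hab hinv ⊢
    rcases lt_or_ge (b : ℕ) i with hb | hb
    · exact lt_of_forall_succ_lt_castSucc (a := 0) (b := i - 1)
        (fun k _ hk => hdesI k (by omega)) (by omega) hab (by omega)
    rcases lt_or_ge (a : ℕ) i with ha | ha
    · by_contra hcon
      have hlt : w⁻¹ a < w⁻¹ b :=
        lt_of_le_of_ne (not_lt.1 hcon) fun e => hab.ne (w⁻¹.injective e)
      have hja : j ≤ i - 1 - a := by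
        have hp := hτ (τ₀⁻¹ a)
        have hq := hτ (τ₀⁻¹ b)
        simp only [Equiv.Perm.coe_inv, Equiv.apply_symm_apply] at hp hq
        rw [Fin.lt_def, Equiv.Perm.coe_inv] at hinv
        omega
      have hpos := hsmall (i - 1 - a) a (by omega)
      have := lt_of_forall_succ_lt_castSucc hdesJ (hja.trans hpos) hlt (by omega)
      simp only [Equiv.Perm.coe_inv, Equiv.apply_symm_apply] at this
      exact lt_asymm hab this
    · exact lt_of_forall_succ_lt_castSucc (a := i) (b := n)
        (fun k hk _ => hdesI k (by omega)) ha hab (by omega)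
end
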